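/- arXiv:2409.05534 — 4 statements merged into one kernel-verified Lean document; each statement's English description precedes it below -/
import Mathlib

section
/- Let F be a field, σ : F → F a field automorphism of finite order m, T ⊆ ℤ, and (S_d)_{d∈T} a family of elements of F. Suppose ε = (ε_1,…,ε_ν) and η = (η_1,…,η_ν) in F^ν satisfy S_d = Σ_{k=1}^ν ε_k·σ^d(η_k) for all d ∈ T. (i) If the entries of η are linearly independent over F^σ and the code C_(σ,η,T) ⊆ F^ν contains only the zero vector, then ε is the unique vector ε' ∈ F^ν with S_d = Σ_{k=1}^ν ε'_k·σ^d(η_k) for all d ∈ T. (ii) If the entries of ε are linearly independent over F^σ and the code C_(σ^{-1},ε,T) ⊆ F^ν contains only the zero vector, then η is the unique vector η' ∈ F^ν with σ^{-d}(S_d) = Σ_{k=1}^ν η'_k·σ^{-d}(ε_k) for all d ∈ T. -/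
/-- The fixed subfield of a field automorphism `σ : F ≃+* F`. -/
def fixedField {F : Type*} [Field F] (σ : F ≃+* F) : Subfield F where
  carrier := {x | σ x = x}
  mul_mem' := by
    intro a b ha hb
    simp only [Set.mem_setOf_eq] at *
    rw [map_mul, ha, hb]
  one_mem' := by simp only [Set.mem_setOf_eq, map_one]
  add_mem' := by
    intro a b ha hb
    simp only [Set.mem_setOf_eq] at *
    rw [map_add, ha, hb]
  zero_mem' := by simp only [Set.mem_setOf_eq, map_zero]
  neg_mem' := by
    intro a ha
    simp only [Set.mem_setOf_eq] at *
    rw [map_neg, ha]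
  inv_mem' := by
    intro a ha
    simp only [Set.mem_setOf_eq] at *
    rw [map_inv₀, ha]

/-- The code `C_(θ,h,T)`. -/
def code {F : Type*} [Field F] {ι : Type*} [Fintype ι] (θ : F ≃+* F) (h : ι → F)
    (T : Set ℤ) : Set (ι → F) :=
  {v : ι → F | ∀ i ∈ T, ∑ j, v j * (θ ^ i) (h j) = 0}

/-- Two vectors with the same syndromes agree when the code is trivial. -/
theorem eq_of_syndromes_eq {F : Type*} [Field F] {ι : Type*} [Fintype ι] {θ : F ≃+* F}
    {h : ι → F} {T : Set ℤ} (hcode : ∀ v ∈ code θ h T, v = 0) {v w : ι → F}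
    (hvw : ∀ i ∈ T, ∑ j, v j * (θ ^ i) (h j) = ∑ j, w j * (θ ^ i) (h j)) : v = w := by
  refine sub_eq_zero.mp (hcode _ fun i hi => ?_)
  simp only [Pi.sub_apply, sub_mul, Finset.sum_sub_distrib, hvw i hi, sub_self]

/-- Applying `θ ^ (-d)` to a syndrome exchanges the two vectors. -/
theorem zpow_neg_syndrome {F : Type*} [Field F] {ι : Type*} [Fintype ι] (θ : F ≃+* F)
    (v h : ι → F) (d : ℤ) :
    (θ ^ (-d)) (∑ k, v k * (θ ^ d) (h k)) = ∑ k, h k * (θ ^ (-d)) (v k) := by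
  have hinv (x : F) : (θ ^ (-d)) ((θ ^ d) x) = x := by
    rw [← RingAut.mul_apply, ← zpow_add, neg_add_cancel, zpow_zero, RingAut.one_apply]
  simp only [map_sum, map_mul, hinv, mul_comm]

/-- Uniqueness of the error values given the error locators, and vice versa. -/
theorem error_values_locators_unique {F : Type*} [Field F]
    (σ : F ≃+* F) (m : ℕ) (hm0 : 0 < m) (hord : orderOf σ = m)
    (T : Set ℤ) (S : ℤ → F) (ν : ℕ) (ε η : Fin ν → F)
    (hsol : ∀ d ∈ T, S d = ∑ k, ε k * (σ ^ d) (η k)) :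
    ((LinearIndependent (fixedField σ) η → (∀ v ∈ code σ η T, v = 0) →
      ∀ ε' : Fin ν → F, (∀ d ∈ T, S d = ∑ k, ε' k * (σ ^ d) (η k)) → ε' = ε)
    ∧
    (LinearIndependent (fixedField σ) ε → (∀ v ∈ code σ⁻¹ ε T, v = 0) →
      ∀ η' : Fin ν → F,
        (∀ d ∈ T, (σ ^ (-d)) (S d) = ∑ k, η' k * (σ ^ (-d)) (ε k)) → η' = η)) := by
  refine ⟨fun _ hcode ε' hε' => eq_of_syndromes_eq hcode fun d hd => ?_,
    fun _ hcode η' hη' => eq_of_syndromes_eq hcode fun d hd => ?_⟩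
  · rw [← hε' d hd, hsol d hd]
  · rw [inv_zpow', ← hη' d hd, hsol d hd, zpow_neg_syndrome]
end

section
/- Let F be a field, σ : F → F a field automorphism of finite order m, t1 an integer with gcd(m, t1) = 1, and b, t2, δ ≥ 2, r ≥ 0, k_0 < … < k_r integers. Let ε = (ε_1,…,ε_ν) and η = (η_1,…,η_ν) in F^ν each have entries linearly independent over F^σ, assume ν ≤ δ−2, and set s_i^{(j)} = Σ_{k=1}^ν ε_k·σ^{b + t1·i + t2·k_j}(η_k) and s̃_i^{(j)} = σ^{−b − t1·i − t2·k_j}(s_i^{(j)}) for 0 ≤ i ≤ δ−2, 0 ≤ j ≤ r. Let ς ∈ F^{ν+1} be the unique vector with ς_ν = 1 and Σ_{l=0}^ν ς_l·σ^{t1·l}(ε_k) = 0 for all k, and let λ ∈ F^{ν+1} be the unique vector with λ_ν = 1 and Σ_{l=0}^ν λ_l·σ^{−t1·l}(η_k) = 0 for all k. Let H_ν be the (δ−1−ν)(r+1) × ν matrix with rows (σ^{b+t1·i+t2·k_j}(η_1), …, σ^{b+t1·i+t2·k_j}(η_ν)) for ν ≤ i ≤ δ−2, 0 ≤ j ≤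 r, and E_ν the matrix with rows (σ^{−b−t1·i−t2·k_j}(ε_1), …, σ^{−b−t1·i−t2·k_j}(ε_ν)) for the same index range. (i) If rank(H_ν) = ν, then ς is a σ^{t1}-SFSR of length ν for the r+1 sequences (s_0^{(j)},…,s_{δ−2}^{(j)}), and every σ^{t1}-SFSR of length at most ν for these sequences is a nonzero F-scalar multiple of ς. (ii) If rank(E_ν) = ν, then λ is a σ^{−t1}-SFSR of length ν for the r+1 sequences (s̃_0^{(j)},…,s̃_{δ−2}^{(j)}), and every σ^{−t1}-SFSR of length at most ν for these sequences is a nonzero F-scalar multiple of λ. -/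
/-- `v` is a `θ`-skew-feedback shift register of length `ℓ` for the `L` sequences
`s 0, …, s (L-1)` of length `N` of elements of `F`. -/
def IsSFSR {F : Type*} [Field F] (θ : F ≃+* F) (L N : ℕ) (s : Fin L → ℕ → F)
    (ℓ : ℕ) (v : Fin (ℓ + 1) → F) : Prop :=
  v 0 ≠ 0 ∧ ∀ j : Fin L, ∀ n : ℕ, ℓ ≤ n → n < N →
    ∑ i : Fin (ℓ + 1), v i * (θ ^ (i : ℕ)) (s j (n - (i : ℕ))) = 0

open Finset in
/-- The columns of the Moore matrix of elements that are linearly independent over the fixed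
field are linearly independent. -/
theorem moore_columns_eq_zero {F : Type*} [Field F] (θ : F ≃+* F) :
    ∀ (n : ℕ) (x : Fin n → F), LinearIndependent (fixedField θ) x →
      ∀ u : Fin n → F, (∀ i < n, ∑ k, u k * (θ ^ i) (x k) = 0) → u = 0 := by
  intro n
  induction n with
  | zero => intro x _ u _; exact Subsingleton.elim _ _
  | succ n ih =>
    intro x hx u hu
    have hinit : LinearIndependent (fixedField θ) (fun k : Fin n => x k.castSucc) :=
      hx.comp _ (Fin.castSucc_injective n)
    have hzero_of_last (w : Fin (n + 1) → F) (hlast : w (Fin.last n) = 0)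
        (hw : ∀ i < n, ∑ k, w k * (θ ^ i) (x k) = 0) : w = 0 := by
      have h := ih _ hinit (fun k => w k.castSucc) fun i hi => by
        simpa [Fin.sum_univ_castSucc, hlast] using hw i hi
      funext k
      refine Fin.lastCases hlast (fun k => congrFun h k) k
    by_contra hne
    have hlast : u (Fin.last n) ≠ 0 := fun h =>
      hne (hzero_of_last u h fun i hi => hu i (hi.trans n.lt_succ_self))
    set w : Fin (n + 1) → F := fun k => (u (Fin.last n))⁻¹ * u k with hw_def
    have hw_last : w (Fin.last n) = 1 := inv_mul_cancel₀ hlast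
    have hw (i : ℕ) (hi : i < n + 1) : ∑ k, w k * (θ ^ i) (x k) = 0 := by
      simp only [hw_def, mul_assoc, ← mul_sum, hu i hi, mul_zero]
    have hfix : (fun k => θ.symm (w k) - w k) = 0 := by
      refine hzero_of_last _ (by simp [hw_last]) fun i hi => ?_
      have h := congrArg θ.symm (hw (i + 1) (by omega))
      simp only [map_sum, map_mul, map_zero, pow_succ', RingAut.mul_apply,
        RingEquiv.symm_apply_apply] at h
      simp only [sub_mul, sum_sub_distrib, h, hw i (by omega), sub_zero]
    have hmem (k) : w k ∈ fixedField θ := by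
      have h : θ.symm (w k) = w k := sub_eq_zero.mp (congrFun hfix k)
      exact ((RingEquiv.symm_apply_eq θ).mp h).symm
    have h := Fintype.linearIndependent_iff.mp hx (fun k => ⟨w k, hmem k⟩)
      (by simpa [Subfield.smul_def] using hw 0 n.succ_pos) (Fin.last n)
    have : w (Fin.last n) = 0 := congrArg Subtype.val h
    exact one_ne_zero (hw_last.symm.trans this)

/-- A skew polynomial of degree less than `n` that vanishes at `n` elements linearly independent
over the fixed field is zero. -/
theorem moore_rows_eq_zero {F : Type*} [Field F] (θ : F ≃+* F) {n : ℕ} {x : Fin n → F}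
    (hx : LinearIndependent (fixedField θ) x) (v : Fin n → F)
    (hv : ∀ k, ∑ i : Fin n, v i * (θ ^ (i : ℕ)) (x k) = 0) : v = 0 := by
  set M : Matrix (Fin n) (Fin n) F := Matrix.of fun i k => (θ ^ (i : ℕ)) (x k)
  refine Matrix.eq_zero_of_vecMul_eq_zero (M := M) (fun hdet => ?_) (funext hv)
  obtain ⟨u, hu, h⟩ := Matrix.exists_mulVec_eq_zero_iff.mpr hdet
  refine hu (moore_columns_eq_zero θ n x hx u fun i hi => ?_)
  simpa [M, Matrix.mulVec, dotProduct, mul_comm] using congrFun h ⟨i, hi⟩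

/-- A matrix whose rank is its number of columns has trivial kernel. -/
theorem Matrix.eq_zero_of_mulVec_eq_zero_of_rank_eq {F ι : Type*} [Field F] [Fintype ι] {n : ℕ}
    {M : Matrix ι (Fin n) F} (hM : M.rank = n) {u : Fin n → F}
    (hu : M.mulVec u = 0) : u = 0 := by
  have hker : LinearMap.ker M.mulVecLin = ⊥ := by
    have h := M.mulVecLin.finrank_range_add_finrank_ker
    rw [show Module.finrank F (LinearMap.range M.mulVecLin) = n from hM,
      Module.finrank_fin_fun] at h
    exact Submodule.finrank_eq_zero.mp (by omega)
  exact (LinearMap.ker_eq_bot'.mp hker) u hu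

/-- A power of `σ` with exponent coprime to the order of `σ` has the same fixed field. -/
theorem fixedField_zpow {F : Type*} [Field F] (σ : F ≃+* F) {t : ℤ}
    (ht : Int.gcd (orderOf σ : ℤ) t = 1) : fixedField (σ ^ t) = fixedField σ := by
  have hpow (τ : F ≃+* F) (n : ℤ) : fixedField τ ≤ fixedField (τ ^ n) := fun x hx => by
    have h : τ ∈ MulAction.stabilizer (F ≃+* F) x := hx
    exact zpow_mem h n
  refine le_antisymm ?_ (hpow σ t)
  have hbez := Int.gcd_eq_gcd_ab (orderOf σ : ℤ) t
  rw [ht] at hbez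
  have hσ : (σ ^ t) ^ Int.gcdB (orderOf σ : ℤ) t = σ := by
    have h : σ ^ ((orderOf σ : ℤ) * Int.gcdA (orderOf σ : ℤ) t
        + t * Int.gcdB (orderOf σ : ℤ) t) = σ := by
      rw [← hbez]; simp
    rwa [zpow_add, zpow_mul, zpow_mul, zpow_natCast, pow_orderOf_eq_one, one_zpow, one_mul] at h
  simpa only [hσ] using hpow (σ ^ t) (Int.gcdB (orderOf σ : ℤ) t)

/-- The discrepancy of a feedback vector at a syndrome sequence, expressed through its values
at the errors. -/
theorem sum_feedback_syndrome {F : Type*} [Field F] (σ : F ≃+* F) (c t : ℤ) {ν : ℕ}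
    (ε η : Fin ν → F) (s : ℕ → F)
    (hs : ∀ i, s i = ∑ k, ε k * (σ ^ (c + t * (i : ℤ))) (η k))
    {ℓ n : ℕ} (hn : ℓ ≤ n) (v : Fin (ℓ + 1) → F) :
    ∑ i : Fin (ℓ + 1), v i * ((σ ^ t) ^ (i : ℕ)) (s (n - i)) =
      ∑ k, (σ ^ (c + t * (n : ℤ))) (η k) *
        ∑ i : Fin (ℓ + 1), v i * ((σ ^ t) ^ (i : ℕ)) (ε k) := by
  simp only [hs, map_sum, map_mul, Finset.mul_sum]
  rw [Finset.sum_comm]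
  refine Finset.sum_congr rfl fun k _ => Finset.sum_congr rfl fun i _ => ?_
  have hσ : (σ ^ t) ^ (i : ℕ) * σ ^ (c + t * ((n - (i : ℕ) : ℕ) : ℤ)) = σ ^ (c + t * (n : ℤ)) := by
    rw [← zpow_natCast, ← zpow_mul, ← zpow_add, Nat.cast_sub (by omega)]
    congr 1
    ring
  rw [← RingAut.mul_apply, hσ]
  ring

/-- If the matrix of powers of `η` has full rank, the monic skew polynomial annihilating the
independent elements `ε` is, up to scalars, the unique shortest feedback vector. -/
theorem shortest_sfsr_of_rank_of_linearIndependent {F : Type*} [Field F] (σ : F ≃+* F)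
    (t : ℤ) {N L ν : ℕ} (c : Fin L → ℤ) (ε η : Fin ν → F)
    (hε : LinearIndependent (fixedField (σ ^ t)) ε)
    (s : Fin L → ℕ → F)
    (hs : ∀ j i, s j i = ∑ k, ε k * (σ ^ (c j + t * (i : ℤ))) (η k))
    (ς : Fin (ν + 1) → F) (hςlast : ς (Fin.last ν) = 1)
    (hς : ∀ k, ∑ l : Fin (ν + 1), ς l * ((σ ^ t) ^ (l : ℕ)) (ε k) = 0)
    (H : Matrix (Fin (N - ν) × Fin L) (Fin ν) F)
    (hH : ∀ p k, H p k = (σ ^ (c p.2 + t * ((ν + p.1 : ℕ) : ℤ))) (η k))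
    (hrank : H.rank = ν) :
    IsSFSR (σ ^ t) L N s ν ς ∧
      ∀ ℓ' : ℕ, ℓ' ≤ ν → ∀ w : Fin (ℓ' + 1) → F, IsSFSR (σ ^ t) L N s ℓ' w →
        ∃ hl : ℓ' = ν, ∃ a : F, a ≠ 0 ∧
          ∀ l : Fin (ℓ' + 1), w l = a * ς (Fin.cast (by omega) l) := by
  refine ⟨⟨fun h0 => ?_, fun j n hn _ => ?_⟩, fun ℓ hℓ w hw => ?_⟩
  · -- dividing by `σ ^ t` would leave an annihilator of too small a degree
    have h := moore_rows_eq_zero (σ ^ t) hε (fun l => (σ ^ t).symm (ς l.succ)) fun k => by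
      have h := congrArg (σ ^ t).symm (hς k)
      simpa only [Fin.sum_univ_succ, h0, zero_mul, zero_add, map_sum, map_mul, map_zero,
        Fin.val_succ, pow_succ', RingAut.mul_apply, RingEquiv.symm_apply_apply] using h
    cases ν with
    | zero => exact one_ne_zero (hςlast.symm.trans h0)
    | succ ν =>
      have hl : (σ ^ t).symm (ς (Fin.last (ν + 1))) = 0 := congrFun h (Fin.last ν)
      simp [hςlast] at hl
  · simp only [sum_feedback_syndrome σ (c j) t ε η (s j) (hs j) hn ς, hς, mul_zero,
      Finset.sum_const_zero]
  have hwε (k) : ∑ i : Fin (ℓ + 1), w i * ((σ ^ t) ^ (i : ℕ)) (ε k) = 0 := by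
    refine congrFun (Matrix.eq_zero_of_mulVec_eq_zero_of_rank_eq hrank
      (u := fun k => ∑ i : Fin (ℓ + 1), w i * ((σ ^ t) ^ (i : ℕ)) (ε k)) ?_) k
    funext p
    have h := hw.2 p.2 (ν + p.1) (by omega) (by omega)
    rw [sum_feedback_syndrome σ (c p.2) t ε η (s p.2) (hs p.2) (by omega) w] at h
    simpa only [Matrix.mulVec, dotProduct, hH, Pi.zero_apply] using h
  obtain rfl | hlt := hℓ.eq_or_lt
  · have hdiff := moore_rows_eq_zero (σ ^ t) hε
      (fun l => w l.castSucc - w (Fin.last ℓ) * ς l.castSucc) fun k => by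
        have h1 := hwε k
        have h2 := hς k
        rw [Fin.sum_univ_castSucc] at h1 h2
        simp only [sub_mul, Finset.sum_sub_distrib, mul_assoc, ← Finset.mul_sum]
        simp only [Fin.val_castSucc] at h1 h2
        rw [hςlast] at h2
        linear_combination h1 - w (Fin.last ℓ) * h2
    have hmul (l) : w l = w (Fin.last ℓ) * ς l :=
      Fin.lastCases (by rw [hςlast, mul_one]) (fun l => sub_eq_zero.mp (congrFun hdiff l)) l
    exact ⟨rfl, w (Fin.last ℓ), fun h => hw.1 (by rw [hmul, h, zero_mul]), hmul⟩
  · have hw_zero := moore_rows_eq_zero (σ ^ t)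
      (hε.comp (Fin.castLE hlt) (Fin.castLE_injective hlt)) w fun k => hwε _
    exact absurd (congrFun hw_zero 0) hw.1


/-- If the matrix `H_ν` (resp. `E_ν`) has rank `ν`, then the error span (resp. error
locator) vector is, up to nonzero scalar multiples, the unique shortest skew-feedback
shift register generating the syndrome sequences. -/
theorem shortest_sfsr_of_rank {F : Type*} [Field F]
    (σ : F ≃+* F) (m : ℕ) (hm0 : 0 < m) (hord : orderOf σ = m)
    (b t1 t2 : ℤ) (ht1 : Int.gcd (m : ℤ) t1 = 1)
    (δ r ν : ℕ) (hδ : 2 ≤ δ) (hν : ν ≤ δ - 2)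
    (kk : Fin (r + 1) → ℤ) (hkk : StrictMono kk)
    (ε η : Fin ν → F)
    (hε : LinearIndependent (fixedField σ) ε)
    (hη : LinearIndependent (fixedField σ) η)
    (s st : Fin (r + 1) → ℕ → F)
    (hs : ∀ j i, s j i = ∑ k, ε k * (σ ^ (b + t1 * (i : ℤ) + t2 * kk j)) (η k))
    (hst : ∀ j i, st j i = (σ ^ (-(b + t1 * (i : ℤ) + t2 * kk j))) (s j i))
    (ς : Fin (ν + 1) → F) (hςlast : ς (Fin.last ν) = 1)
    (hς : ∀ k, ∑ l : Fin (ν + 1), ς l * (σ ^ (t1 * ((l : ℕ) : ℤ))) (ε k) = 0)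
    (lc : Fin (ν + 1) → F) (hlclast : lc (Fin.last ν) = 1)
    (hlc : ∀ k, ∑ l : Fin (ν + 1), lc l * (σ ^ (-(t1 * ((l : ℕ) : ℤ)))) (η k) = 0)
    (H E : Matrix (Fin (δ - 1 - ν) × Fin (r + 1)) (Fin ν) F)
    (hH : ∀ p k, H p k = (σ ^ (b + t1 * ((ν : ℤ) + ((p.1 : ℕ) : ℤ)) + t2 * kk p.2)) (η k))
    (hE : ∀ p k, E p k = (σ ^ (-(b + t1 * ((ν : ℤ) + ((p.1 : ℕ) : ℤ)) + t2 * kk p.2))) (ε k)) :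
    (H.rank = ν →
      IsSFSR (σ ^ t1) (r + 1) (δ - 1) s ν ς ∧
      ∀ ℓ' : ℕ, ℓ' ≤ ν → ∀ w : Fin (ℓ' + 1) → F, IsSFSR (σ ^ t1) (r + 1) (δ - 1) s ℓ' w →
        ∃ hl : ℓ' = ν, ∃ c : F, c ≠ 0 ∧
          ∀ l : Fin (ℓ' + 1), w l = c * ς (Fin.cast (by omega) l))
    ∧
    (E.rank = ν →
      IsSFSR (σ ^ (-t1)) (r + 1) (δ - 1) st ν lc ∧
      ∀ ℓ' : ℕ, ℓ' ≤ ν → ∀ w : Fin (ℓ' + 1) → F, IsSFSR (σ ^ (-t1)) (r + 1) (δ - 1) st ℓ' w →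
        ∃ hl : ℓ' = ν, ∃ c : F, c ≠ 0 ∧
          ∀ l : Fin (ℓ' + 1), w l = c * lc (Fin.cast (by omega) l)) := by
  have hfix : fixedField (σ ^ t1) = fixedField σ := fixedField_zpow σ (by rw [hord, ht1])
  have hfix_neg : fixedField (σ ^ (-t1)) = fixedField σ :=
    fixedField_zpow σ (by rw [hord, Int.gcd_neg, ht1])
  refine ⟨shortest_sfsr_of_rank_of_linearIndependent σ t1
      (fun j => b + t2 * kk j) ε η (by rwa [hfix]) s (fun j i => ?_) ς hςlast (fun k => ?_)
      H (fun p k => ?_),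
    shortest_sfsr_of_rank_of_linearIndependent σ (-t1)
      (fun j => -(b + t2 * kk j)) η ε (by rwa [hfix_neg]) st (fun j i => ?_) lc hlclast
      (fun k => ?_) E (fun p k => ?_)⟩
  · simp only [hs, add_right_comm]
  · simpa only [zpow_mul, zpow_natCast] using hς k
  · simp only [hH, add_right_comm, Nat.cast_add]
  · rw [hst, hs, map_sum]
    refine Finset.sum_congr rfl fun k _ => ?_
    rw [map_mul, ← RingAut.mul_apply, ← zpow_add, neg_add_cancel, zpow_zero, RingAut.one_apply,
      mul_comm, show -(b + t1 * (i : ℤ) + t2 * kk j) = -(b + t2 * kk j) + -t1 * (i : ℤ) by ring]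
  · simpa only [← neg_mul, zpow_mul, zpow_natCast] using hlc k
  · rw [hE, Nat.cast_add, show -(b + t1 * ((ν : ℤ) + ((p.1 : ℕ) : ℤ)) + t2 * kk p.2) =
      -(b + t2 * kk p.2) + -t1 * ((ν : ℤ) + ((p.1 : ℕ) : ℤ)) by ring]
end

section
/- Let F be a field, σ : F → F a field automorphism of finite order m, n ≤ m, h ∈ F^n with entries linearly independent over F^σ, and C ⊆ F^n. Let δ ≥ 2, r ≥ 0, b, t1, t2 be integers with gcd(m, t1) = 1 and k_0 < … < k_r integers such that every integer b + t1·i + t2·k_j (0 ≤ i ≤ δ−2, 0 ≤ j ≤ r) lies in the h-defining set T_h^σ(C). Let y = c + e with c ∈ C, e ∈ F^n and rkw(e) = ν, let ε = (ε_1,…,ε_ν) be an F^σ-basis of the F^σ-span of the entries of e, and let ς ∈ F^{ν+1} be the unique vector with ς_ν = 1 and Σ_{l=0}^ν ς_l·σ^{t1·l}(ε_k) = 0 for all 1 ≤ k ≤ ν. Set s_i^{(j)} = Σ_{l=1}^n y_l·σ^{b+t1·i+t2·k_j}(h_l) and T_ν = { b + t1·(ν+i) + t2·k_j : 0 ≤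 i ≤ δ−2−ν, 0 ≤ j ≤ r }. Assume ν ≤ δ−2 and that there exist integers b', t1', t2', δ' ≥ 2, r' ≥ 0 with δ' + r' > ν such that either (i) gcd(m, t1') = 1, gcd(m, t2') < δ', and every element of { b' + t1'·i + t2'·j : 0 ≤ i ≤ δ'−2, 0 ≤ j ≤ r' } is congruent modulo m to some element of T_ν, or (ii) there exist integers k'_0 < … < k'_{r'} with gcd(m, t1') = 1 = gcd(m, t2'), k'_{r'} − k'_0 ≤ δ' + r' − 2, and every element of { b' + t1'·i + t2'·k'_j : 0 ≤ i ≤ δ'−2, 0 ≤ j ≤ r' } is congruent modulo m to some element of T_ν. Then ς is a σ^{t1}-SFSR of length ν for the r+1 sequences (s_0^{(j)},…,s_{δ−2}^{(j)}) (0 ≤ j ≤ r), and every σ^{t1}-SFSR of length at most ν for these sequences is a nonzero F-scalar multiple of ς. -/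
/-- The rank weight of a vector. -/
noncomputable def rankWeight {F : Type*} [Field F] (σ : F ≃+* F) {n : ℕ} (v : Fin n → F) : ℕ :=
  Module.finrank (fixedField σ) (Submodule.span (fixedField σ) (Set.range v))

/-- The `h`-defining set of a set of vectors `C ⊆ F^n` with respect to `σ`. -/
def definingSet {F : Type*} [Field F] (σ : F ≃+* F) {n : ℕ} (h : Fin n → F)
    (C : Set (Fin n → F)) : Set ℤ :=
  {i : ℤ | ∀ c ∈ C, ∑ j, c j * (σ ^ i) (h j) = 0}

theorem zpow_add_apply {F : Type*} [Field F] (σ : F ≃+* F) (a b : ℤ) (z : F) :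
    (σ ^ (a + b)) z = (σ ^ a) ((σ ^ b) z) := by
  rw [zpow_add, RingAut.mul_apply]

theorem zpow_pow_apply {F : Type*} [Field F] (σ : F ≃+* F) (a : ℤ) (i : ℕ) (z : F) :
    ((σ ^ a) ^ i) z = (σ ^ (a * (i : ℤ))) z := by
  rw [zpow_mul, zpow_natCast]

theorem zpow_eq_of_orderOf_dvd_sub {F : Type*} [Field F] (σ : F ≃+* F) {a b : ℤ}
    (hab : (orderOf σ : ℤ) ∣ a - b) : σ ^ a = σ ^ b := by
  rw [zpow_eq_zpow_iff_modEq]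
  exact (Int.modEq_iff_dvd.mpr hab).symm

theorem zpow_apply_fixedField {F : Type*} [Field F] (σ : F ≃+* F) (a : fixedField σ) (t : ℤ) :
    (σ ^ t) (a : F) = a := by
  have h1 : σ ∈ MulAction.stabilizer (F ≃+* F) (a : F) := a.2
  exact Subgroup.zpow_mem _ h1 t

/-- Elements that are linearly independent over the fixed field have linearly independent
orbits under `σ`. -/
theorem eq_zero_of_sum_mul_zpow_eq_zero {F ι : Type*} [Field F] (σ : F ≃+* F) {x : ι → F}
    (hx : LinearIndependent (fixedField σ) x) (s : Finset ι) (u : ι → F)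
    (hu : ∀ t : ℤ, ∑ k ∈ s, u k * (σ ^ t) (x k) = 0) : ∀ k ∈ s, u k = 0 := by
  classical
  induction s using Finset.induction_on generalizing u with
  | empty => simp
  | insert a s ha ih =>
    by_cases hua : u a = 0
    · intro k hk
      rcases Finset.mem_insert.mp hk with rfl | hk
      · exact hua
      · refine ih u (fun t => ?_) k hk
        simpa [Finset.sum_insert ha, hua] using hu t
    exfalso
    set v : ι → F := fun k => (u a)⁻¹ * u k with hv
    have hva : v a = 1 := inv_mul_cancel₀ hua
    have hvt : ∀ t : ℤ, ∑ k ∈ insert a s, v k * (σ ^ t) (x k) = 0 := by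
      intro t
      simp only [hv, mul_assoc]
      rw [← Finset.mul_sum, hu t, mul_zero]
    have hfix : ∀ k ∈ s, σ (v k) - v k = 0 := by
      refine ih (fun k => σ (v k) - v k) (fun t => ?_)
      have h1 := congrArg σ (hvt (t - 1))
      have h2 : ∀ k, σ ((σ ^ (t - 1)) (x k)) = (σ ^ t) (x k) := by
        intro k
        have := zpow_add_apply σ 1 (t - 1) (x k)
        rw [add_sub_cancel, zpow_one] at this
        exact this.symm
      simp only [map_sum, map_mul, map_zero, h2] at h1
      have h3 := hvt t
      rw [Finset.sum_insert ha] at h1 h3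
      rw [hva, map_one] at h1
      rw [hva] at h3
      simp only [sub_mul, Finset.sum_sub_distrib]
      linear_combination h1 - h3
    have hmem : ∀ k ∈ insert a s, v k ∈ fixedField σ := by
      intro k hk
      rcases Finset.mem_insert.mp hk with rfl | hk
      · rw [hva]; exact one_mem _
      · exact sub_eq_zero.mp (hfix k hk)
    let g : ι → fixedField σ := fun k => if hk : k ∈ insert a s then ⟨v k, hmem k hk⟩ else 0
    have hg : ∑ k ∈ insert a s, g k • x k = 0 := by
      rw [← hvt 0]
      refine Finset.sum_congr rfl fun k hk => ?_
      simp only [g, dif_pos hk, zpow_zero, RingAut.one_apply]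
      rfl
    have h4 := linearIndependent_iff'.mp hx _ g hg a (Finset.mem_insert_self a s)
    simp only [g, dif_pos (Finset.mem_insert_self a s)] at h4
    have h5 : v a = 0 := congrArg Subtype.val h4
    exact one_ne_zero (hva.symm.trans h5)

/-- The `F`-span of the vectors `σ ^ t (x)` for `t ∈ T`, with `σ` acting entrywise. -/
def conjSpan {F ι : Type*} [Field F] (σ : F ≃+* F) (x : ι → F) (T : Set ℤ) :
    Submodule F (ι → F) :=
  Submodule.span F ((fun (t : ℤ) (k : ι) => (σ ^ t) (x k)) '' T)

section ConjSpan

variable {F ι : Type*} [Field F] (σ : F ≃+* F) {x : ι → F}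

theorem zpow_mem_conjSpan {T : Set ℤ} {t : ℤ} (ht : t ∈ T) :
    (fun k => (σ ^ t) (x k)) ∈ conjSpan σ x T :=
  Submodule.subset_span ⟨t, ht, rfl⟩

theorem conjSpan_le {T : Set ℤ} {V : Submodule F (ι → F)}
    (hT : ∀ t ∈ T, (fun k => (σ ^ t) (x k)) ∈ V) : conjSpan σ x T ≤ V := by
  rw [conjSpan, Submodule.span_le]
  rintro _ ⟨t, ht, rfl⟩
  exact hT t ht

theorem conjSpan_mono {S T : Set ℤ} (hST : S ⊆ T) : conjSpan σ x S ≤ conjSpan σ x T :=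
  Submodule.span_mono (Set.image_mono hST)

theorem conjSpan_invariant {S : Set ℤ} {a : ℤ}
    (ha : ∀ s ∈ S, (fun k => (σ ^ (a + s)) (x k)) ∈ conjSpan σ x S) {v : ι → F}
    (hv : v ∈ conjSpan σ x S) : (fun k => (σ ^ a) (v k)) ∈ conjSpan σ x S := by
  unfold conjSpan at hv
  induction hv using Submodule.span_induction with
  | mem v hv =>
    obtain ⟨s, hs, rfl⟩ := hv
    simpa only [zpow_add_apply] using ha s hs
  | zero =>
    simp only [Pi.zero_apply, map_zero]
    exact zero_mem _
  | add v w _ _ hv hw =>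
    simp only [Pi.add_apply, map_add]
    exact add_mem hv hw
  | smul c v _ hv =>
    simp only [Pi.smul_apply, smul_eq_mul, map_mul]
    exact Submodule.smul_mem _ ((σ ^ a) c) hv

theorem zpow_add_mul_mem_conjSpan {S : Set ℤ} {a : ℤ}
    (ha : ∀ s ∈ S, (fun k => (σ ^ (a + s)) (x k)) ∈ conjSpan σ x S) {s : ℤ}
    (hs : (fun k => (σ ^ s) (x k)) ∈ conjSpan σ x S) (j : ℕ) :
    (fun k => (σ ^ (s + a * (j : ℤ))) (x k)) ∈ conjSpan σ x S := by
  induction j with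
  | zero => simpa using hs
  | succ j ih =>
    have h1 := conjSpan_invariant σ ha ih
    simp only [← zpow_add_apply] at h1
    convert h1 using 4
    push_cast
    ring

variable [Fintype ι]

theorem eq_top_of_forall_zpow_mem (hx : LinearIndependent (fixedField σ) x)
    {V : Submodule F (ι → F)} (hV : ∀ t : ℤ, (fun k => (σ ^ t) (x k)) ∈ V) : V = ⊤ := by
  classical
  by_contra hne
  obtain ⟨f, hf0, hf⟩ := Submodule.exists_le_ker_of_lt_top V (lt_top_iff_ne_top.mpr hne)
  have hu : ∀ k ∈ Finset.univ, f (Pi.single k 1) = 0 := by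
    refine eq_zero_of_sum_mul_zpow_eq_zero σ hx Finset.univ _ fun t => ?_
    have h1 : f (fun k => (σ ^ t) (x k)) = 0 := hf (hV t)
    rw [LinearMap.pi_apply_eq_sum_univ f] at h1
    rw [← h1]
    refine Finset.sum_congr rfl fun k _ => ?_
    rw [smul_eq_mul, mul_comm]
    congr 2
    ext j
    simp [Pi.single_apply, eq_comm]
  apply hf0
  refine LinearMap.pi_ext' fun k => ?_
  ext
  simpa using hu k (Finset.mem_univ k)

theorem min_card_finrank_conjSpan_add_one_le {S T : Set ℤ} (hST : S ⊆ T)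
    (h : conjSpan σ x T ≤ conjSpan σ x S → conjSpan σ x S = ⊤) :
    min (Fintype.card ι) (Module.finrank F (conjSpan σ x S) + 1) ≤
      Module.finrank F (conjSpan σ x T) := by
  by_cases hle : conjSpan σ x T ≤ conjSpan σ x S
  · have h1 : conjSpan σ x T = ⊤ := (le_antisymm hle (conjSpan_mono σ hST)).trans (h hle)
    rw [h1, finrank_top, Module.finrank_fintype_fun_eq_card]
    exact min_le_left _ _
  · exact (min_le_right _ _).trans
      (Submodule.finrank_lt_finrank_of_lt (lt_of_le_not_ge (conjSpan_mono σ hST) hle))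

end ConjSpan

theorem exists_nat_gcd_modEq {m : ℕ} (hm : 0 < m) {t s : ℤ} (hs : (Int.gcd (m : ℤ) t : ℤ) ∣ s) :
    ∃ j : ℕ, (m : ℤ) ∣ s - t * (j : ℤ) := by
  obtain ⟨q, rfl⟩ := hs
  have hm' : (0 : ℤ) < m := by exact_mod_cast hm
  refine ⟨((Int.gcdB m t * q) % m).toNat, ?_⟩
  rw [Int.toNat_of_nonneg (Int.emod_nonneg _ hm'.ne'), Int.gcd_eq_gcd_ab]
  have h1 := Int.mul_ediv_add_emod (Int.gcdB m t * q) m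
  exact ⟨Int.gcdA m t * q + t * (Int.gcdB m t * q / m), by linear_combination -t * h1⟩

section Bounds

variable {F ι : Type*} [Field F] [Fintype ι] (σ : F ≃+* F) {m : ℕ} {x : ι → F}

theorem min_card_le_finrank_conjSpan (hm : 0 < m) (hord : orderOf σ = m)
    (hx : LinearIndependent (fixedField σ) x) (b t : ℤ) (ht : Int.gcd (m : ℤ) t = 1) (d : ℕ) :
    min (Fintype.card ι) d ≤
      Module.finrank F (conjSpan σ x {z | ∃ i : ℕ, i < d ∧ z = b + t * (i : ℤ)}) := by
  induction d with
  | zero => simp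
  | succ d ih =>
    refine le_trans ?_ (min_card_finrank_conjSpan_add_one_le σ
      (S := {z | ∃ i : ℕ, i < d ∧ z = b + t * (i : ℤ)}) ?_ fun hle => ?_)
    · omega
    · rintro z ⟨i, hi, rfl⟩
      exact ⟨i, by omega, rfl⟩
    refine eq_top_of_forall_zpow_mem σ hx fun s => ?_
    obtain ⟨j, hj⟩ := exists_nat_gcd_modEq hm (t := t) (s := s - b) (by simp [ht])
    have h0 := hle (zpow_mem_conjSpan σ ⟨0, by omega, rfl⟩)
    have h1 := zpow_add_mul_mem_conjSpan σ (a := t) (x := x) ?_ h0 j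
    · rwa [← zpow_eq_of_orderOf_dvd_sub σ (a := s)] at h1
      rw [hord]
      convert hj using 1
      push_cast
      ring
    · rintro z ⟨i, hi, rfl⟩
      exact hle (zpow_mem_conjSpan σ ⟨i + 1, by omega, by push_cast; ring⟩)

theorem hartmannTzeng_conjSpan_eq_top (hm : 0 < m) (hord : orderOf σ = m)
    (hx : LinearIndependent (fixedField σ) x) (b t₁ t₂ : ℤ)
    (δ r : ℕ) (ht₁ : Int.gcd (m : ℤ) t₁ = 1)
    (ht₂ : Int.gcd (m : ℤ) t₂ < δ) (hc : Fintype.card ι < δ + r) :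
    conjSpan σ x {z | ∃ i j : ℕ, i < δ - 1 ∧ j ≤ r ∧ z = b + t₁ * (i : ℤ) + t₂ * (j : ℤ)} = ⊤ := by
  have key : ∀ q : ℕ, min (Fintype.card ι) (δ - 1 + q) ≤ Module.finrank F
      (conjSpan σ x {z | ∃ i j : ℕ, i < δ - 1 ∧ j ≤ q ∧ z = b + t₁ * (i : ℤ) + t₂ * (j : ℤ)}) := by
    intro q
    induction q with
    | zero =>
      refine (min_card_le_finrank_conjSpan σ hm hord hx b t₁ ht₁ (δ - 1)).trans
        (Submodule.finrank_mono (conjSpan_mono σ ?_))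
      rintro z ⟨i, hi, rfl⟩
      exact ⟨i, 0, hi, le_rfl, by simp⟩
    | succ q ih =>
      refine le_trans ?_ (min_card_finrank_conjSpan_add_one_le σ
        (S := {z | ∃ i j : ℕ, i < δ - 1 ∧ j ≤ q ∧ z = b + t₁ * (i : ℤ) + t₂ * (j : ℤ)})
        ?_ fun hle => ?_)
      · omega
      · rintro z ⟨i, j, hi, hj, rfl⟩
        exact ⟨i, j, hi, by omega, rfl⟩
      refine eq_top_of_forall_zpow_mem σ hx fun s => ?_
      have hgpos : 0 < Int.gcd (m : ℤ) t₂ := Int.gcd_pos_of_ne_zero_left _ (by omega)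
      obtain ⟨i₀, hi₀⟩ := exists_nat_gcd_modEq hm (t := t₁) (s := s - b) (by simp [ht₁])
      obtain ⟨i₁, hlt, h2⟩ : ∃ i₁ < Int.gcd (m : ℤ) t₂,
          (Int.gcd (m : ℤ) t₂ : ℤ) ∣ (i₀ : ℤ) - (i₁ : ℤ) :=
        ⟨_, Nat.mod_lt i₀ hgpos, by push_cast; exact Int.dvd_self_sub_emod⟩
      have hgi : (Int.gcd (m : ℤ) t₂ : ℤ) ∣ s - b - t₁ * (i₁ : ℤ) := by
        have h3 := ((Int.gcd_dvd_left _ _).trans hi₀).add (h2.mul_left t₁)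
        rwa [mul_sub, sub_add_sub_cancel] at h3
      obtain ⟨j, hj⟩ := exists_nat_gcd_modEq hm hgi
      have h0 : (fun k => (σ ^ (b + t₁ * (i₁ : ℤ))) (x k)) ∈
          conjSpan σ x
            {z | ∃ i j : ℕ, i < δ - 1 ∧ j ≤ q ∧ z = b + t₁ * (i : ℤ) + t₂ * (j : ℤ)} :=
        zpow_mem_conjSpan σ ⟨i₁, 0, by omega, by omega, by simp⟩
      have h1 := zpow_add_mul_mem_conjSpan σ (a := t₂) (x := x) ?_ h0 j
      · rwa [← zpow_eq_of_orderOf_dvd_sub σ (a := s)] at h1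
        rw [hord]
        convert hj using 1
        ring
      · rintro z ⟨i, j, hi, hj, rfl⟩
        exact hle (zpow_mem_conjSpan σ ⟨i, j + 1, hi, by omega, by push_cast; ring⟩)
  apply Submodule.eq_top_of_finrank_eq
  rw [Module.finrank_fintype_fun_eq_card]
  refine le_antisymm ?_ (le_trans ?_ (key r))
  · simpa using Submodule.finrank_le (conjSpan σ x
      {z | ∃ i j : ℕ, i < δ - 1 ∧ j ≤ r ∧ z = b + t₁ * (i : ℤ) + t₂ * (j : ℤ)})
  · omega

/-- Orthogonal conjugate spans have complementary dimensions. -/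
theorem finrank_conjSpan_add_finrank_conjSpan_le {y : ι → F} {S T : Set ℤ}
    (h : ∀ s ∈ S, ∀ t ∈ T, ∑ k, (σ ^ s) (y k) * (σ ^ t) (x k) = 0) :
    Module.finrank F (conjSpan σ y S) + Module.finrank F (conjSpan σ x T) ≤ Fintype.card ι := by
  classical
  have hS : conjSpan σ y S ≤
      ((conjSpan σ x T).map (dotProductEquiv F ι).toLinearMap).dualCoannihilator := by
    refine conjSpan_le σ fun s hs => ?_
    rw [Submodule.mem_dualCoannihilator]
    rintro _ ⟨v, hv, rfl⟩
    have hT : conjSpan σ x T ≤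
        LinearMap.ker (dotProductEquiv F ι (fun k => (σ ^ s) (y k))) := by
      refine conjSpan_le σ fun t ht => ?_
      simpa [dotProduct] using h s hs t ht
    have hv0 := hT hv
    simpa [dotProduct_comm] using hv0
  have h1 := Submodule.finrank_mono hS
  have h2 := Subspace.finrank_add_finrank_dualCoannihilator_eq
    ((conjSpan σ x T).map (dotProductEquiv F ι).toLinearMap)
  rw [LinearEquiv.finrank_map_eq, Module.finrank_fintype_fun_eq_card] at h2
  omega

theorem linearIndependent_zpow {ν : ℕ} {z : Fin ν → F} (hm : 0 < m) (hord : orderOf σ = m)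
    (hz : LinearIndependent (fixedField σ) z) (b t : ℤ) (ht : Int.gcd (m : ℤ) t = 1) :
    LinearIndependent F
      (fun (l : Fin ν) (k : Fin ν) => (σ ^ (b + t * ((l : ℕ) : ℤ))) (z k)) := by
  rw [linearIndependent_iff_card_le_finrank_span]
  have h1 := min_card_le_finrank_conjSpan σ hm hord hz b t ht ν
  rw [Fintype.card_fin, min_self] at h1
  rw [Fintype.card_fin]
  refine h1.trans (Submodule.finrank_mono (conjSpan_le σ ?_))
  rintro _ ⟨i, hi, rfl⟩
  exact Submodule.subset_span ⟨⟨i, hi⟩, rfl⟩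

/-- Transfer of the pairing of `e` with the conjugates of `h` to a basis `ε` of the span of `e`. -/
theorem exists_linearIndependent_pairing {n ν : ℕ} {h e : Fin n → F}
    (hh : LinearIndependent (fixedField σ) h) {ε : Fin ν → F}
    (hε : LinearIndependent (fixedField σ) ε)
    (hspan : Submodule.span (fixedField σ) (Set.range ε) =
      Submodule.span (fixedField σ) (Set.range e)) :
    ∃ x : Fin ν → F, LinearIndependent (fixedField σ) x ∧
      ∀ t : ℤ, ∑ l, e l * (σ ^ t) (h l) = ∑ k, ε k * (σ ^ t) (x k) := by
  have h1 : ∀ l, ∃ a : Fin ν → fixedField σ, ∑ k, a k • ε k = e l := fun l =>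
    (Submodule.mem_span_range_iff_exists_fun _).mp
      (hspan ▸ Submodule.subset_span (Set.mem_range_self l))
  have h2 : ∀ k, ∃ a : Fin n → fixedField σ, ∑ l, a l • e l = ε k := fun k =>
    (Submodule.mem_span_range_iff_exists_fun _).mp
      (hspan ▸ Submodule.subset_span (Set.mem_range_self k))
  choose A hA using h1
  choose B hB using h2
  refine ⟨fun k => ∑ l, A l k • h l, ?_, fun t => ?_⟩
  · rw [Fintype.linearIndependent_iff]
    intro c hc
    have hcA : ∀ l, ∑ k, c k * A l k = 0 := by
      refine Fintype.linearIndependent_iff.mp hh _ ?_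
      rw [← hc]
      simp only [Finset.smul_sum, Finset.sum_smul, smul_smul]
      exact Finset.sum_comm
    have hBA : ∀ j k, ∑ l, B j l * A l k = if k = j then 1 else 0 := by
      intro j k
      have h3 := Fintype.linearIndependent_iff.mp hε
        (fun k => (∑ l, B j l * A l k) - if k = j then 1 else 0) ?_ k
      · exact sub_eq_zero.mp h3
      simp only [sub_smul, Finset.sum_sub_distrib, ite_smul, one_smul, zero_smul,
        Finset.sum_ite_eq', Finset.mem_univ, if_true]
      rw [sub_eq_zero, ← hB j]
      simp only [← hA, Finset.smul_sum, Finset.sum_smul, smul_smul]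
      exact Finset.sum_comm
    intro j
    calc c j = ∑ k, c k * ∑ l, B j l * A l k := by simp [hBA]
      _ = ∑ l, B j l * ∑ k, c k * A l k := by
        simp only [Finset.mul_sum]
        rw [Finset.sum_comm]
        exact Finset.sum_congr rfl fun l _ => Finset.sum_congr rfl fun k _ => by ring
      _ = 0 := by simp [hcA]
  · simp only [← hA, Subfield.smul_def, smul_eq_mul, map_sum, map_mul, zpow_apply_fixedField,
      Finset.sum_mul, Finset.mul_sum]
    rw [Finset.sum_comm]
    exact Finset.sum_congr rfl fun l _ => Finset.sum_congr rfl fun k _ => by ring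

theorem eq_zero_of_hartmannTzeng (hm : 0 < m) (hord : orderOf σ = m)
    (hx : LinearIndependent (fixedField σ) x) (b t₁ t₂ : ℤ) (δ r : ℕ)
    (ht₁ : Int.gcd (m : ℤ) t₁ = 1) (ht₂ : Int.gcd (m : ℤ) t₂ < δ)
    (hc : Fintype.card ι < δ + r) (u : ι → F)
    (hu : ∀ i < δ - 1, ∀ j ≤ r,
      ∑ k, u k * (σ ^ (b + t₁ * (i : ℤ) + t₂ * (j : ℤ))) (x k) = 0) : u = 0 := by
  classical
  have htop := hartmannTzeng_conjSpan_eq_top σ hm hord hx b t₁ t₂ δ r ht₁ ht₂ hc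
  have hle : (⊤ : Submodule F (ι → F)) ≤ LinearMap.ker (dotProductEquiv F ι u) := by
    rw [← htop]
    refine conjSpan_le σ ?_
    rintro _ ⟨i, j, hi, hj, rfl⟩
    simpa [dotProduct] using hu i hi j hj
  exact (dotProductEquiv F ι).map_eq_zero_iff.mp (LinearMap.ker_eq_top.mp (top_le_iff.mp hle))

theorem exists_basis_span_range {K V : Type*} [Field K] [AddCommGroup V] [Module K V] {ν : ℕ}
    (u : Fin ν → V) : ∃ w ≤ ν, ∃ η : Fin w → V, LinearIndependent K η ∧
      Submodule.span K (Set.range η) = Submodule.span K (Set.range u) := by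
  have : Module.Finite K (Submodule.span K (Set.range u)) :=
    FiniteDimensional.span_of_finite _ (Set.finite_range u)
  let B := Module.finBasis K (Submodule.span K (Set.range u))
  refine ⟨_, ?_, fun a => (B a : V), B.linearIndependent.map' _ (Submodule.ker_subtype _), ?_⟩
  · simpa [Set.finrank] using finrank_range_le_card (R := K) u
  · have h1 := congrArg (Submodule.map (Submodule.subtype _)) B.span_eq
    rw [Submodule.map_span, Submodule.map_subtype_top, ← Set.range_comp] at h1
    exact h1

theorem eq_zero_of_roos_orthogonal {w : ℕ} {x η : Fin w → F} (hm : 0 < m) (hord : orderOf σ = m)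
    (hx : LinearIndependent (fixedField σ) x) (hη : LinearIndependent (fixedField σ) η) (b t₁ t₂ : ℤ) (δ r : ℕ) (hδ : 2 ≤ δ)
    (ht₁ : Int.gcd (m : ℤ) t₁ = 1) (ht₂ : Int.gcd (m : ℤ) t₂ = 1)
    (hc : w < δ + r) (κ : Fin (r + 1) → ℤ) (hκ : StrictMono κ)
    (hκr : κ (Fin.last r) - κ 0 ≤ (δ : ℤ) + (r : ℤ) - 2)
    (h : ∀ i < δ - 1, ∀ j : Fin (r + 1),
      ∑ k, η k * (σ ^ (b + t₁ * (i : ℤ) + t₂ * κ j)) (x k) = 0) : w = 0 := by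
  classical
  obtain ⟨K, hK⟩ : ∃ K : ℕ, (K : ℤ) = κ (Fin.last r) - κ 0 :=
    ⟨_, Int.toNat_of_nonneg (sub_nonneg.mpr (hκ.monotone (Fin.zero_le _)))⟩
  let J : Finset ℤ := Finset.univ.image κ
  have hJcard : J.card = r + 1 := by
    rw [Finset.card_image_of_injective _ hκ.injective, Finset.card_univ, Fintype.card_fin]
  have hJsub : J ⊆ Finset.Icc (κ 0) (κ (Fin.last r)) := by
    intro q hq
    obtain ⟨j, -, rfl⟩ := Finset.mem_image.mp hq
    exact Finset.mem_Icc.mpr ⟨hκ.monotone (Fin.zero_le _), hκ.monotone (Fin.le_last _)⟩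
  have hRcard : (Finset.Icc (κ 0) (κ (Fin.last r)) \ J).card + (r + 1) = K + 1 := by
    have h1 := Finset.card_sdiff_add_card_eq_card hJsub
    rw [hJcard, Int.card_Icc] at h1
    omega
  set U := conjSpan σ η {q | ∃ j, q = -t₂ * κ j} with hU
  have ht₂' : Int.gcd (m : ℤ) (-t₂) = 1 := by rwa [Int.gcd_neg]
  have horth := finrank_conjSpan_add_finrank_conjSpan_le σ (y := η) (x := x)
    (S := {q | ∃ j, q = -t₂ * κ j}) (T := {q | ∃ i : ℕ, i < δ - 1 ∧ q = b + t₁ * (i : ℤ)}) ?_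
  swap
  · rintro _ ⟨j, rfl⟩ _ ⟨i, hi, rfl⟩
    have h2 := congrArg (σ ^ (-t₂ * κ j)) (h i hi j)
    simp only [map_sum, map_mul, map_zero, ← zpow_add_apply] at h2
    rw [← h2]
    refine Finset.sum_congr rfl fun k _ => ?_
    congr 3
    ring
  have hW := min_card_le_finrank_conjSpan σ hm hord hx b t₁ ht₁ (δ - 1)
  have hU1 : min w 1 ≤ Module.finrank F U := by
    have h1 := min_card_le_finrank_conjSpan σ hm hord hη (-t₂ * κ 0) (-t₂) ht₂' 1
    rw [Fintype.card_fin] at h1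
    refine h1.trans (Submodule.finrank_mono (conjSpan_mono σ ?_))
    rintro _ ⟨i, hi, rfl⟩
    exact ⟨0, by simp [Nat.lt_one_iff.mp hi]⟩
  have hUK : min w (K + 1) ≤
      Module.finrank F U + (Finset.Icc (κ 0) (κ (Fin.last r)) \ J).card := by
    have h1 := min_card_le_finrank_conjSpan σ hm hord hη (-t₂ * κ 0) (-t₂) ht₂' (K + 1)
    rw [Fintype.card_fin] at h1
    let R : Finset (Fin w → F) := (Finset.Icc (κ 0) (κ (Fin.last r)) \ J).image
      fun q k => (σ ^ (-t₂ * q)) (η k)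
    have h2 : conjSpan σ η {q | ∃ i : ℕ, i < K + 1 ∧ q = -t₂ * κ 0 + -t₂ * (i : ℤ)} ≤
        U ⊔ Submodule.span F (R : Set (Fin w → F)) := by
      refine conjSpan_le σ ?_
      rintro _ ⟨i, hi, rfl⟩
      rw [← mul_add]
      by_cases hmem : κ 0 + (i : ℤ) ∈ J
      · obtain ⟨j, -, hj⟩ := Finset.mem_image.mp hmem
        exact Submodule.mem_sup_left (zpow_mem_conjSpan σ ⟨j, by rw [hj]⟩)
      · refine Submodule.mem_sup_right (Submodule.subset_span ?_)
        refine Finset.mem_coe.mpr (Finset.mem_image.mpr ⟨κ 0 + (i : ℤ), ?_, rfl⟩)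
        rw [Finset.mem_sdiff, Finset.mem_Icc]
        exact ⟨⟨by omega, by omega⟩, hmem⟩
    calc min w (K + 1) ≤ _ := h1
      _ ≤ _ := Submodule.finrank_mono h2
      _ ≤ _ := Submodule.finrank_add_le_finrank_add_finrank _ _
      _ ≤ _ := Nat.add_le_add_left
        ((finrank_span_finset_le_card R).trans Finset.card_image_le) _
  rw [Fintype.card_fin] at horth hW
  rw [← hU] at horth
  omega

theorem eq_zero_of_roos {ν : ℕ} {z : Fin ν → F} (hm : 0 < m) (hord : orderOf σ = m)
    (hz : LinearIndependent (fixedField σ) z) (b t₁ t₂ : ℤ) (δ r : ℕ) (hδ : 2 ≤ δ)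
    (ht₁ : Int.gcd (m : ℤ) t₁ = 1) (ht₂ : Int.gcd (m : ℤ) t₂ = 1)
    (hc : ν < δ + r) (κ : Fin (r + 1) → ℤ) (hκ : StrictMono κ)
    (hκr : κ (Fin.last r) - κ 0 ≤ (δ : ℤ) + (r : ℤ) - 2) (u : Fin ν → F)
    (hu : ∀ i < δ - 1, ∀ j : Fin (r + 1),
      ∑ k, u k * (σ ^ (b + t₁ * (i : ℤ) + t₂ * κ j)) (z k) = 0) : u = 0 := by
  obtain ⟨w, hwν, η, hη, hηspan⟩ := exists_basis_span_range (K := fixedField σ) u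
  obtain ⟨x, hx, hpair⟩ := exists_linearIndependent_pairing σ hz hη hηspan
  have hw0 : w = 0 :=
    eq_zero_of_roos_orthogonal σ hm hord hx hη b t₁ t₂ δ r hδ ht₁ ht₂ (by omega) κ hκ hκr
      fun i hi j => by rw [← hpair]; exact hu i hi j
  subst hw0
  rw [Set.range_eq_empty, Submodule.span_empty, eq_comm, Submodule.span_eq_bot] at hηspan
  exact funext fun k => hηspan _ (Set.mem_range_self k)

end Bounds

/-- Under the error-correcting capacity assumption, the error span vector is, up to
nonzero scalar multiples, the unique shortest `σ^t1`-skew-feedback shift register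
generating the syndrome sequences. -/
theorem error_span_is_shortest_sfsr {F : Type*} [Field F]
    (σ : F ≃+* F) (m : ℕ) (hm0 : 0 < m) (hord : orderOf σ = m)
    {n : ℕ} (hn : n ≤ m) (h : Fin n → F)
    (hh : LinearIndependent (fixedField σ) h)
    (C : Set (Fin n → F))
    (δ r : ℕ) (hδ : 2 ≤ δ) (b t1 t2 : ℤ) (ht1 : Int.gcd (m : ℤ) t1 = 1)
    (kk : Fin (r + 1) → ℤ) (hkk : StrictMono kk)
    (hT : ∀ i : ℕ, i ≤ δ - 2 → ∀ j : Fin (r + 1),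
      b + t1 * (i : ℤ) + t2 * kk j ∈ definingSet σ h C)
    (y c e : Fin n → F) (hc : c ∈ C) (hy : y = c + e)
    (ν : ℕ) (hν : rankWeight σ e = ν)
    (ε : Fin ν → F) (hεli : LinearIndependent (fixedField σ) ε)
    (hεspan : Submodule.span (fixedField σ) (Set.range ε) =
      Submodule.span (fixedField σ) (Set.range e))
    (ς : Fin (ν + 1) → F) (hςlast : ς (Fin.last ν) = 1)
    (hς : ∀ k, ∑ l : Fin (ν + 1), ς l * (σ ^ (t1 * ((l : ℕ) : ℤ))) (ε k) = 0)
    (s : Fin (r + 1) → ℕ → F)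
    (hs : ∀ j i, s j i = ∑ l, y l * (σ ^ (b + t1 * (i : ℤ) + t2 * kk j)) (h l))
    (hνδ : ν ≤ δ - 2)
    (hassump : ∃ (b' t1' t2' : ℤ) (δ' r' : ℕ), 2 ≤ δ' ∧ ν < δ' + r' ∧
      ((Int.gcd (m : ℤ) t1' = 1 ∧ Int.gcd (m : ℤ) t2' < δ' ∧
        ∀ i : ℕ, i ≤ δ' - 2 → ∀ j : ℕ, j ≤ r' →
          ∃ (i' : ℕ) (j' : Fin (r + 1)), i' ≤ δ - 2 - ν ∧
            (m : ℤ) ∣ (b' + t1' * (i : ℤ) + t2' * (j : ℤ)) -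
              (b + t1 * ((ν : ℤ) + (i' : ℤ)) + t2 * kk j'))
       ∨
       (Int.gcd (m : ℤ) t1' = 1 ∧ Int.gcd (m : ℤ) t2' = 1 ∧
        ∃ k' : Fin (r' + 1) → ℤ, StrictMono k' ∧
          k' (Fin.last r') - k' 0 ≤ (δ' : ℤ) + (r' : ℤ) - 2 ∧
          ∀ i : ℕ, i ≤ δ' - 2 → ∀ j : Fin (r' + 1),
            ∃ (i' : ℕ) (j' : Fin (r + 1)), i' ≤ δ - 2 - ν ∧
              (m : ℤ) ∣ (b' + t1' * (i : ℤ) + t2' * k' j) -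
                (b + t1 * ((ν : ℤ) + (i' : ℤ)) + t2 * kk j')))) :
    IsSFSR (σ ^ t1) (r + 1) (δ - 1) s ν ς ∧
    ∀ ℓ' : ℕ, ℓ' ≤ ν → ∀ w : Fin (ℓ' + 1) → F, IsSFSR (σ ^ t1) (r + 1) (δ - 1) s ℓ' w →
      ∃ hl : ℓ' = ν, ∃ c' : F, c' ≠ 0 ∧
        ∀ l : Fin (ℓ' + 1), w l = c' * ς (Fin.cast (by omega) l) := by
  obtain ⟨x, hx, hpair⟩ := exists_linearIndependent_pairing σ hh hεli hεspan
  have hord' : (orderOf σ : ℤ) = m := by exact_mod_cast hord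
  have hsyn : ∀ j : Fin (r + 1), ∀ i : ℕ, i ≤ δ - 2 →
      s j i = ∑ k, ε k * (σ ^ (b + t1 * (i : ℤ) + t2 * kk j)) (x k) := by
    intro j i hi
    rw [hs, ← hpair, hy]
    simp only [Pi.add_apply, add_mul, Finset.sum_add_distrib]
    rw [hT i hi j c hc, zero_add]
  have hfeed : ∀ (ℓ : ℕ) (v : Fin (ℓ + 1) → F) (j : Fin (r + 1)) (N : ℕ), ℓ ≤ N → N < δ - 1 →
      ∑ i : Fin (ℓ + 1), v i * ((σ ^ t1) ^ (i : ℕ)) (s j (N - (i : ℕ))) =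
        ∑ k, (∑ i : Fin (ℓ + 1), v i * (σ ^ (t1 * ((i : ℕ) : ℤ))) (ε k)) *
          (σ ^ (b + t1 * (N : ℤ) + t2 * kk j)) (x k) := by
    intro ℓ v j N hℓ hN
    simp only [Finset.sum_mul]
    rw [Finset.sum_comm]
    refine Finset.sum_congr rfl fun i _ => ?_
    have hi := i.2
    rw [hsyn j _ (by omega), map_sum, Finset.mul_sum]
    refine Finset.sum_congr rfl fun k _ => ?_
    rw [map_mul, zpow_pow_apply, zpow_pow_apply, ← zpow_add_apply, mul_assoc]
    congr 4
    push_cast [show (i : ℕ) ≤ N by omega]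
    ring
  have hindep := fun a => Fintype.linearIndependent_iff.mp
    (linearIndependent_zpow σ hm0 hord hεli a t1 ht1)
  refine ⟨⟨fun h0 => ?_, fun j N hN hNδ => ?_⟩, fun ℓ' hℓ' w hw => ?_⟩
  · have hsucc := hindep t1 (fun l => ς l.succ) (by
      funext k
      have h1 := hς k
      rw [Fin.sum_univ_succ, h0, zero_mul, zero_add] at h1
      simp only [Finset.sum_apply, Pi.smul_apply, smul_eq_mul, Pi.zero_apply]
      rw [← h1]
      refine Finset.sum_congr rfl fun l _ => ?_
      congr 3
      rw [Fin.val_succ]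
      push_cast
      ring)
    rcases Fin.eq_zero_or_eq_succ (Fin.last ν) with h1 | ⟨l, h1⟩
    · rw [h1, h0] at hςlast
      exact zero_ne_one hςlast
    · rw [h1, hsucc l] at hςlast
      exact zero_ne_one hςlast
  · rw [hfeed ν ς j N hN hNδ]
    simp only [hς, zero_mul, Finset.sum_const_zero]
  set u : Fin ν → F := fun k => ∑ i : Fin (ℓ' + 1), w i * (σ ^ (t1 * ((i : ℕ) : ℤ))) (ε k) with hu
  have horth : ∀ (z : ℤ) (i' : ℕ) (j' : Fin (r + 1)), i' ≤ δ - 2 - ν →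
      (m : ℤ) ∣ z - (b + t1 * ((ν : ℤ) + (i' : ℤ)) + t2 * kk j') →
      ∑ k, u k * (σ ^ z) (x k) = 0 := by
    intro z i' j' hi' hz
    rw [zpow_eq_of_orderOf_dvd_sub σ (hord'.symm ▸ hz)]
    have h1 := hw.2 j' (ν + i') (by omega) (by omega)
    rw [hfeed ℓ' w j' (ν + i') (by omega) (by omega)] at h1
    exact_mod_cast h1
  have hu0 : u = 0 := by
    obtain ⟨b', t1', t2', δ', r', hδ', hνδ', hcase⟩ := hassump
    rcases hcase with ⟨hg1, hg2, hcov⟩ | ⟨hg1, hg2, k', hk', hkr, hcov⟩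
    · refine eq_zero_of_hartmannTzeng σ hm0 hord hx b' t1' t2' δ' r' hg1 hg2 (by simpa) u ?_
      intro i hi j hj
      obtain ⟨i', j', hi', hd⟩ := hcov i (by omega) j hj
      exact horth _ i' j' hi' hd
    · refine eq_zero_of_roos σ hm0 hord hx b' t1' t2' δ' r' hδ' hg1 hg2 hνδ' k' hk' hkr u ?_
      intro i hi j
      obtain ⟨i', j', hi', hd⟩ := hcov i (by omega) j
      exact horth _ i' j' hi' hd
  have hw0 : w 0 ≠ 0 := hw.1
  rcases hℓ'.lt_or_eq with hlt | rfl
  · exfalso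
    let p : Fin ν → F := fun l => if hl : (l : ℕ) < ℓ' + 1 then w ⟨l, hl⟩ else 0
    have hp : ∀ l, p l = 0 := hindep 0 p (by
      funext k
      have h1 := congrFun hu0 k
      simp only [Finset.sum_apply, Pi.smul_apply, smul_eq_mul, zero_add]
      rw [← h1, hu]
      refine (Finset.sum_of_injOn (Fin.castLE (by omega)) (Fin.castLE_injective _).injOn
        (fun _ _ => Finset.mem_coe.mpr (Finset.mem_univ _)) ?_ ?_).symm
      · intro l _ hl
        have : ¬ (l : ℕ) < ℓ' + 1 := fun hlt' => hl ⟨⟨l, hlt'⟩, by simp, rfl⟩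
        simp only [p, dif_neg this, zero_mul]
      · intro l _
        simp only [p, Fin.val_castLE, dif_pos l.2, Fin.eta])
    exact hw0 (by simpa [p] using hp ⟨0, by omega⟩)
  · have hp := hindep 0 (fun l => w l.castSucc - w (Fin.last ℓ') * ς l.castSucc) (by
      funext k
      have h1 := congrFun hu0 k
      have h2 := hς k
      simp only [hu, Pi.zero_apply] at h1
      rw [Fin.sum_univ_castSucc] at h1 h2
      rw [hςlast] at h2
      simp only [Finset.sum_apply, Pi.smul_apply, smul_eq_mul, zero_add, sub_mul,
        Finset.sum_sub_distrib, mul_assoc, ← Finset.mul_sum, Pi.zero_apply]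
      simp only [Fin.val_castSucc] at h1 h2
      linear_combination h1 - w (Fin.last ℓ') * h2)
    have hall : ∀ l, w l = w (Fin.last ℓ') * ς l := by
      intro l
      induction l using Fin.lastCases with
      | last => rw [hςlast, mul_one]
      | cast l => exact sub_eq_zero.mp (hp l)
    exact ⟨rfl, w (Fin.last ℓ'), fun h0 => hw0 (by rw [hall 0, h0, zero_mul]), hall⟩
end

section
/- Let F be a field, σ : F → F a field automorphism of finite order m, n ≤ m, h ∈ F^n with entries linearly independent over F^σ, and C ⊆ F^n. Let δ ≥ 2, r ≥ 0, b, t1, t2 be integers with gcd(m, t1) = 1 and k_0 < … < k_r integers such that every integer b + t1·i + t2·k_j (0 ≤ i ≤ δ−2, 0 ≤ j ≤ r) lies in the h-defining set T_h^σ(C). Let y = c + e with c ∈ C, e ∈ F^n and rkw(e) = ν, let ε = (ε_1,…,ε_ν) be an F^σ-basis of the F^σ-span of the entries of e, let B be the unique ν×n matrix with entries in F^σ such that e = εB, set η_k = Σ_{l=1}^n B_{k,l}·h_l for 1 ≤ k ≤ ν, and let λ ∈ F^{ν+1} be the unique vector with λ_ν = 1 and Σ_{l=0}^ν λ_l·σ^{−t1·l}(η_k)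 = 0 for all 1 ≤ k ≤ ν. Set s̃_i^{(j)} = σ^{−b−t1·i−t2·k_j}(Σ_{l=1}^n y_l·σ^{b+t1·i+t2·k_j}(h_l)) and T_ν = { b + t1·(ν+i) + t2·k_j : 0 ≤ i ≤ δ−2−ν, 0 ≤ j ≤ r }. Assume ν ≤ δ−2 and that there exist integers b', t1', t2', δ' ≥ 2, r' ≥ 0 with δ' + r' > ν such that either (i) gcd(m, t1') = 1, gcd(m, t2') < δ', and every element of { b' + t1'·i + t2'·j : 0 ≤ i ≤ δ'−2, 0 ≤ j ≤ r' } is congruent modulo m to some element of T_ν, or (ii) there exist integers k'_0 < … < k'_{r'} with gcd(m, t1') = 1 = gcd(m, t2'), k'_{r'} − k'_0 ≤ δ' + r' − 2, and every element of { b' + t1'·i + t2'·k'_j : 0 ≤ i ≤ δ'−2, 0 ≤ j ≤ r' } is congruent modulo m to some element of T_ν. Then λ is a σ^{−t1}-SFSR of length ν for the r+1 sequences (s̃_0^{(j)},…,s̃_{δ−2}^{(j)}) (0 ≤ j ≤ r), and every σ^{−t1}-SFSR of length at most ν for these sequences is a nonzero F-scalar multiple of λ. -/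
section SkewMoore

variable {F : Type*} [Field F]

lemma zpow_apply_eq_of_apply_eq (τ : F ≃+* F) {x : F} (hx : τ x = x) (p : ℤ) :
    (τ ^ p) x = x :=
  (MulAction.stabilizer (F ≃+* F) x).zpow_mem (x := τ) hx p

lemma zpow_add_apply_s14 (σ : F ≃+* F) (p q : ℤ) (x : F) :
    (σ ^ (p + q)) x = (σ ^ p) ((σ ^ q) x) := by
  rw [zpow_add]; rfl

lemma zpow_neg_apply_zpow (σ : F ≃+* F) (p : ℤ) (x : F) :
    (σ ^ (-p)) ((σ ^ p) x) = x := by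
  rw [← zpow_add_apply_s14]; simp

lemma zpow_eq_zpow_of_dvd {σ : F ≃+* F} {m : ℕ} (hσ : σ ^ m = 1) {p q : ℤ}
    (hpq : (m : ℤ) ∣ p - q) : σ ^ p = σ ^ q := by
  obtain ⟨x, hx⟩ := hpq
  obtain rfl : p = m * x + q := by linarith
  rw [zpow_add, zpow_mul, zpow_natCast, hσ, one_zpow, one_mul]

lemma apply_eq_of_zpow_apply_eq {σ : F ≃+* F} {m : ℕ} (hσ : σ ^ m = 1) {t : ℤ}
    (ht : Int.gcd (m : ℤ) t = 1) {x : F} (hx : (σ ^ t) x = x) : σ x = x := by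
  have hb := Int.gcd_eq_gcd_ab (m : ℤ) t
  rw [ht] at hb
  have h1 : σ ^ (1 : ℤ) = σ ^ (t * Int.gcdB m t) :=
    zpow_eq_zpow_of_dvd hσ ⟨Int.gcdA m t, by push_cast at hb; linarith⟩
  have h2 := zpow_apply_eq_of_apply_eq (σ ^ t) hx (Int.gcdB m t)
  rwa [← zpow_mul, ← h1, zpow_one] at h2

lemma LinearIndependent.zpow_apply {σ : F ≃+* F} {ι : Type*} [Fintype ι] {ε : ι → F}
    (hε : LinearIndependent (fixedField σ) ε) (p : ℤ) :
    LinearIndependent (fixedField σ) (fun k => (σ ^ p) (ε k)) := by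
  rw [Fintype.linearIndependent_iff] at hε ⊢
  intro g hg
  apply hε g
  have := congrArg (σ ^ (-p)) hg
  simpa only [map_sum, Subfield.smul_def, smul_eq_mul, map_mul, zpow_neg_apply_zpow, map_zero,
    zpow_apply_eq_of_apply_eq σ (g _).2] using this

/-- The Moore matrix of elements that are linearly independent over the fixed field has
trivial kernel. -/
lemma eq_zero_of_sum_mul_pow_apply_eq_zero {σ τ : F ≃+* F}
    (hfix : ∀ x, τ x = x ↔ σ x = x) (ν : ℕ) :
    ∀ (ε : Fin ν → F), LinearIndependent (fixedField σ) ε → ∀ g : Fin ν → F,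
      (∀ i < ν, ∑ k, g k * (τ ^ i) (ε k) = 0) → g = 0 := by
  induction ν with
  | zero => intro ε _ g _; exact Subsingleton.elim _ _
  | succ ν ih =>
    intro ε hε g hg
    have hε0 : LinearIndependent (fixedField σ) (fun k : Fin ν => ε k.castSucc) :=
      hε.comp _ (Fin.castSucc_injective ν)
    by_cases hl : g (Fin.last ν) = 0
    · have h0 := ih _ hε0 (fun k => g k.castSucc) (fun i hi => by
        have := hg i (by omega)
        rwa [Fin.sum_univ_castSucc, hl, zero_mul, add_zero] at this)
      ext k
      refine Fin.lastCases hl (fun k => congrFun h0 k) k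
    · set u : Fin (ν + 1) → F := fun k => (g (Fin.last ν))⁻¹ * g k with hu
      have hul : u (Fin.last ν) = 1 := inv_mul_cancel₀ hl
      have hu0 : ∀ i < ν + 1, ∑ k, u k * (τ ^ i) (ε k) = 0 := fun i hi => by
        simp only [hu, mul_assoc, ← Finset.mul_sum, hg i hi, mul_zero]
      have hε1 : LinearIndependent (fixedField σ) (fun k : Fin ν => τ (ε k.castSucc)) := by
        rw [Fintype.linearIndependent_iff] at hε0 ⊢
        intro c hc
        apply hε0 c
        apply τ.injective
        rw [map_zero, ← hc, map_sum]
        refine Finset.sum_congr rfl fun k _ => ?_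
        rw [Subfield.smul_def, Subfield.smul_def, smul_eq_mul, smul_eq_mul, map_mul,
          (hfix _).2 (c k).2]
      have h0 := ih _ hε1 (fun k => τ (u k.castSucc) - u k.castSucc) (fun i hi => by
        have e1 := congrArg τ (hu0 i (by omega))
        have e2 := hu0 (i + 1) (by omega)
        rw [map_sum, map_zero, Fin.sum_univ_castSucc, hul] at e1
        rw [Fin.sum_univ_castSucc, hul] at e2
        have c1 : ∀ x, (τ ^ (i + 1)) x = (τ ^ i) (τ x) := fun x => by rw [pow_succ]; rfl
        have c2 : ∀ x, τ ((τ ^ i) x) = (τ ^ i) (τ x) := fun x => by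
          rw [← c1, pow_succ']; rfl
        simp only [map_mul, map_one, c1, c2] at e1 e2
        simp only [sub_mul, Finset.sum_sub_distrib]
        linear_combination e1 - e2)
      have hmem : ∀ k, u k ∈ fixedField σ := fun k => by
        refine Fin.lastCases ?_ (fun k => ?_) k
        · rw [hul]; exact one_mem _
        · exact (hfix _).1 (sub_eq_zero.1 (congrFun h0 k))
      rw [Fintype.linearIndependent_iff] at hε
      have := hε (fun k => ⟨u k, hmem k⟩) (by simpa [Subfield.smul_def] using hu0 0 (by omega))
        (Fin.last ν)
      have h1 : u (Fin.last ν) = 0 := congrArg Subtype.val this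
      rw [hul] at h1
      exact absurd h1 one_ne_zero

/-- The vector of all `σ ^ p (ε k)`. -/
def frobRow (σ : F ≃+* F) {ν : ℕ} (ε : Fin ν → F) (p : ℤ) : Fin ν → F := fun k => (σ ^ p) (ε k)

lemma linearIndependent_frobRow {σ : F ≃+* F} {m : ℕ} (hσ : σ ^ m = 1) {ν : ℕ} {ε : Fin ν → F}
    (hε : LinearIndependent (fixedField σ) ε) {t : ℤ} (ht : Int.gcd (m : ℤ) t = 1) (a : ℤ)
    {N : ℕ} (hN : N ≤ ν) :
    LinearIndependent F (fun i : Fin N => frobRow σ ε (a + t * (i : ℕ))) := by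
  suffices hs : LinearIndependent F (fun i : Fin ν => frobRow σ ε (a + t * (i : ℕ))) from
    hs.comp (Fin.castLE hN) (Fin.castLE_injective hN)
  have hfix : ∀ x, (σ ^ t) x = x ↔ σ x = x := fun x =>
    ⟨apply_eq_of_zpow_apply_eq hσ ht, fun hx => zpow_apply_eq_of_apply_eq σ hx t⟩
  let M : Matrix (Fin ν) (Fin ν) F := fun i => frobRow σ ε (a + t * (i : ℕ))
  change LinearIndependent F M.row
  rw [Matrix.linearIndependent_rows_iff_isUnit, ← Matrix.mulVec_injective_iff_isUnit,
    ← Matrix.coe_mulVecLin, ← LinearMap.ker_eq_bot, LinearMap.ker_eq_bot']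
  intro g hg
  refine eq_zero_of_sum_mul_pow_apply_eq_zero hfix ν _ (hε.zpow_apply a) g fun i hi => ?_
  have := congrFun hg ⟨i, hi⟩
  simp only [Matrix.mulVecLin_apply, Matrix.mulVec, dotProduct, Pi.zero_apply] at this
  rw [← this]
  refine Finset.sum_congr rfl fun k _ => ?_
  rw [mul_comm]
  congr 1
  change _ = (σ ^ (a + t * (i : ℤ))) (ε k)
  rw [add_comm, zpow_add_apply_s14, zpow_mul, zpow_natCast]

lemma le_finrank_of_frobRow_mem {σ : F ≃+* F} {m : ℕ} (hσ : σ ^ m = 1) {ν : ℕ} {ε : Fin ν → F}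
    (hε : LinearIndependent (fixedField σ) ε) {t : ℤ} (ht : Int.gcd (m : ℤ) t = 1) (a : ℤ)
    {N : ℕ} (V : Submodule F (Fin ν → F)) (hV : ∀ i < N, frobRow σ ε (a + t * (i : ℕ)) ∈ V) :
    min ν N ≤ Module.finrank F V := by
  have hli := linearIndependent_frobRow hσ hε ht a (min_le_left ν N)
  have := finrank_span_eq_card hli
  rw [Fintype.card_fin] at this
  rw [← this]
  refine Submodule.finrank_mono (Submodule.span_le.2 ?_)
  rintro _ ⟨i, rfl⟩
  exact hV i (i.2.trans_le (min_le_right _ _))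

lemma exists_dvd_sub_of_gcd_le {m : ℕ} (hm : 0 < m) {t s : ℤ} (ht : Int.gcd (m : ℤ) t = 1)
    {N : ℕ} (hs : Int.gcd (m : ℤ) s ≤ N) (p : ℤ) :
    ∃ i < N, ∃ c : ℕ, (m : ℤ) ∣ p - (t * (i : ℕ) + s * (c : ℕ)) := by
  set d := Int.gcd (m : ℤ) s with hd
  have hd0 : 0 < d := Int.gcd_pos_of_ne_zero_left _ (by exact_mod_cast hm.ne')
  have hdm : (d : ℤ) ∣ m := Int.gcd_dvd_left ..
  have hb := Int.gcd_eq_gcd_ab (m : ℤ) t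
  have hb' := Int.gcd_eq_gcd_ab (m : ℤ) s
  rw [ht] at hb
  rw [← hd] at hb'
  push_cast at hb
  set A := Int.gcdA m t
  set B := Int.gcdB m t
  set A' := Int.gcdA m s
  set B' := Int.gcdB m s
  have hdz : (0 : ℤ) < d := by exact_mod_cast hd0
  have hmz : (0 : ℤ) < m := by exact_mod_cast hm
  obtain ⟨i, hi⟩ := Int.eq_ofNat_of_zero_le (Int.emod_nonneg (p * B) hdz.ne')
  have hilt := Int.emod_lt_of_pos (p * B) hdz
  rw [hi] at hilt
  have hie := Int.emod_add_mul_ediv (p * B) d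
  rw [hi] at hie
  obtain ⟨m', hm'⟩ := hdm
  set q : ℤ := p * m' * A + t * (p * B / d) with hq
  have hpq : p - t * i = d * q := by
    rw [hq]
    have : p = p * (m * A + t * B) := by rw [← hb, mul_one]
    rw [hm'] at this
    linear_combination this - t * hie
  obtain ⟨c, hc⟩ := Int.eq_ofNat_of_zero_le (Int.emod_nonneg (q * B') hmz.ne')
  have hce := Int.emod_add_mul_ediv (q * B') m
  rw [hc] at hce
  refine ⟨i, by omega, c, q * A' + s * (q * B' / m), ?_⟩
  linear_combination hpq + q * hb' - s * hce

/-- The rank-metric Hartmann–Tzeng bound, as a lower bound on the rank of Frobenius rows. -/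
lemma hartmannTzeng_le_finrank {σ : F ≃+* F} {m : ℕ} (hm : 0 < m) (hσ : σ ^ m = 1) {ν : ℕ}
    {ε : Fin ν → F} (hε : LinearIndependent (fixedField σ) ε) {a t s : ℤ}
    (ht : Int.gcd (m : ℤ) t = 1) {N : ℕ} (hs : Int.gcd (m : ℤ) s ≤ N) (j : ℕ) :
    min ν (N + j) ≤ Module.finrank F (Submodule.span F
      {x | ∃ i < N, ∃ j' ≤ j, x = frobRow σ ε (a + t * (i : ℕ) + s * (j' : ℕ))}) := by
  induction j with
  | zero =>
    refine le_finrank_of_frobRow_mem hσ hε ht a _ fun i hi => ?_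
    exact Submodule.subset_span ⟨i, hi, 0, le_rfl, by simp⟩
  | succ j ih =>
    set V := Submodule.span F
      {x | ∃ i < N, ∃ j' ≤ j, x = frobRow σ ε (a + t * (i : ℕ) + s * (j' : ℕ))} with hVdef
    set W := Submodule.span F
      {x | ∃ i < N, ∃ j' ≤ j + 1, x = frobRow σ ε (a + t * (i : ℕ) + s * (j' : ℕ))} with hWdef
    have hVW : V ≤ W := Submodule.span_mono (by
      rintro x ⟨i, hi, j', hj', rfl⟩
      exact ⟨i, hi, j', by omega, rfl⟩)
    rcases Nat.lt_or_ge (Module.finrank F V) (Module.finrank F W) with hlt | hge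
    · omega
    have heq : V = W := Submodule.eq_of_le_of_finrank_le hVW hge
    have hstab : ∀ x ∈ V, (fun k => (σ ^ s) (x k)) ∈ V := by
      intro x hx
      rw [hVdef] at hx
      induction hx using Submodule.span_induction with
      | mem x hx =>
        obtain ⟨i, hi, j', hj', rfl⟩ := hx
        rw [heq]
        refine Submodule.subset_span ⟨i, hi, j' + 1, by omega, ?_⟩
        funext k
        simp only [frobRow, ← zpow_add_apply_s14]
        congr 2
        push_cast
        ring
      | zero =>
        convert V.zero_mem using 1
        exact funext fun k => map_zero (σ ^ s)
      | add x y _ _ hx hy =>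
        convert V.add_mem hx hy using 1
        exact funext fun k => map_add (σ ^ s) (x k) (y k)
      | smul c x _ hx =>
        convert V.smul_mem ((σ ^ s) c) hx using 1
        exact funext fun k => map_mul (σ ^ s) c (x k)
    have hmul : ∀ i < N, ∀ c : ℕ, frobRow σ ε (a + t * (i : ℕ) + s * (c : ℕ)) ∈ V := by
      intro i hi c
      induction c with
      | zero => exact Submodule.subset_span ⟨i, hi, 0, by omega, rfl⟩
      | succ c ihc =>
        convert hstab _ ihc using 1
        funext k
        simp only [frobRow, ← zpow_add_apply_s14]
        congr 2
        push_cast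
        ring
    have hall : ∀ p : ℤ, frobRow σ ε p ∈ V := fun p => by
      obtain ⟨i, hi, c, hc⟩ := exists_dvd_sub_of_gcd_le hm ht hs (p - a)
      have : σ ^ p = σ ^ (a + t * (i : ℕ) + s * (c : ℕ)) :=
        zpow_eq_zpow_of_dvd hσ (by convert hc using 1; ring)
      unfold frobRow
      rw [this]
      exact hmul i hi c
    have := le_finrank_of_frobRow_mem hσ hε (t := 1) (by simp) 0 (N := ν) W
      (fun i _ => heq ▸ hall _)
    omega

lemma eq_zero_of_dotProduct_eq_zero_of_le_finrank {ν : ℕ} {S : Set (Fin ν → F)}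
    (hS : ν ≤ Module.finrank F (Submodule.span F S)) {g : Fin ν → F}
    (hg : ∀ x ∈ S, ∑ k, g k * x k = 0) : g = 0 := by
  have htop : Submodule.span F S = ⊤ :=
    Submodule.eq_top_of_finrank_eq (le_antisymm (Submodule.finrank_le _) (by simpa using hS))
  have hker : Submodule.span F S ≤ LinearMap.ker (dotProductEquiv F (Fin ν) g) :=
    Submodule.span_le.2 fun x hx => by
      simpa [dotProduct] using hg x hx
  rw [htop, top_le_iff, LinearMap.ker_eq_top] at hker
  exact (dotProductEquiv F (Fin ν)).map_eq_zero_iff.1 hker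

lemma finrank_span_add_finrank_span_le {w : ℕ} {S T : Set (Fin w → F)}
    (hST : ∀ x ∈ S, ∀ y ∈ T, ∑ k, x k * y k = 0) :
    Module.finrank F (Submodule.span F S) + Module.finrank F (Submodule.span F T) ≤ w := by
  have h1 := Subspace.finrank_add_finrank_dualAnnihilator_eq (Submodule.span F T)
  rw [Module.finrank_fin_fun] at h1
  have h2 : (Submodule.span F S).map (dotProductEquiv F (Fin w)).toLinearMap ≤
      (Submodule.span F T).dualAnnihilator := by
    rw [Submodule.map_span_le]
    intro x hx
    rw [Submodule.mem_dualAnnihilator]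
    intro y hy
    have : Submodule.span F T ≤ LinearMap.ker (dotProductEquiv F (Fin w) x) :=
      Submodule.span_le.2 fun y hy => by simpa [dotProduct] using hST x hx y hy
    exact this hy
  have h3 := Submodule.finrank_mono h2
  rw [LinearEquiv.finrank_map_eq] at h3
  omega

/-- A coordinate matrix of a spanning family with respect to a basis maps linearly independent
families to linearly independent families. -/
lemma linearIndependent_sum_smul_of_span_eq {K E : Type*} [Field K] [AddCommGroup E] [Module K E]
    {ι κ : Type*} [Fintype ι] [Fintype κ] {ε : ι → E} {e : κ → E} {h : κ → E}
    (hε : LinearIndependent K ε) (hh : LinearIndependent K h)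
    (hspan : Submodule.span K (Set.range ε) = Submodule.span K (Set.range e))
    (B : ι → κ → K) (hB : ∀ l, e l = ∑ k, B k l • ε k) :
    LinearIndependent K (fun k => ∑ l, B k l • h l) := by
  classical
  rw [Fintype.linearIndependent_iff]
  intro c hc
  have hc' : ∀ l, ∑ k, c k * B k l = 0 := by
    refine Fintype.linearIndependent_iff.1 hh _ ?_
    rw [← hc]
    simp only [Finset.smul_sum, Finset.sum_smul, smul_smul]
    exact Finset.sum_comm
  intro a
  have ha : ε a ∈ Submodule.span K (Set.range e) := hspan ▸ Submodule.subset_span ⟨a, rfl⟩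
  obtain ⟨x, hx⟩ := (Submodule.mem_span_range_iff_exists_fun K).1 ha
  have hx' : ∀ k, ∑ l, x l * B k l = if k = a then 1 else 0 := by
    have := Fintype.linearIndependent_iff.1 hε
      (fun k => ∑ l, x l * B k l - if k = a then 1 else 0) (by
        simp only [sub_smul, Finset.sum_sub_distrib, ite_smul, one_smul, zero_smul,
          Finset.sum_ite_eq', Finset.mem_univ, if_true]
        rw [sub_eq_zero, ← hx]
        simp only [hB, Finset.smul_sum, Finset.sum_smul, smul_smul]
        exact Finset.sum_comm)
    exact fun k => sub_eq_zero.1 (this k)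
  calc c a = ∑ k, c k * ∑ l, x l * B k l := by simp [hx']
    _ = ∑ l, x l * ∑ k, c k * B k l := by
      simp only [Finset.mul_sum]
      rw [Finset.sum_comm]
      exact Finset.sum_congr rfl fun _ _ => Finset.sum_congr rfl fun _ _ => by ring
    _ = 0 := by simp [hc']

lemma min_le_finrank_span_frobRow_add {σ : F ≃+* F} {m : ℕ} (hσ : σ ^ m = 1) {w : ℕ}
    {ε : Fin w → F} (hε : LinearIndependent (fixedField σ) ε) {t : ℤ}
    (ht : Int.gcd (m : ℤ) t = 1) {r : ℕ} {k : Fin (r + 1) → ℤ} (hk : StrictMono k) :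
    ∃ L : ℕ, (L : ℤ) = k (Fin.last r) - k 0 + 1 ∧ r + 1 ≤ L ∧
      min w L ≤ Module.finrank F
        (Submodule.span F (Set.range fun j => frobRow σ ε (t * k j))) + (L - (r + 1)) := by
  classical
  let I := Finset.Icc (k 0) (k (Fin.last r))
  let J := Finset.univ.image k
  have hJI : J ⊆ I := by
    intro x hx
    obtain ⟨j, -, rfl⟩ := Finset.mem_image.1 hx
    exact Finset.mem_Icc.2 ⟨hk.monotone (Fin.zero_le j), hk.monotone (Fin.le_last j)⟩
  have hJc : J.card = r + 1 := by
    rw [Finset.card_image_of_injective _ hk.injective, Finset.card_univ, Fintype.card_fin]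
  have hle : k 0 ≤ k (Fin.last r) := hk.monotone (Fin.zero_le _)
  have hL : (I.card : ℤ) = k (Fin.last r) - k 0 + 1 := by
    rw [Int.card_Icc]; omega
  refine ⟨I.card, hL, hJc ▸ Finset.card_le_card hJI, ?_⟩
  set Y := Submodule.span F (Set.range fun j => frobRow σ ε (t * k j)) with hY
  let D := (I \ J).image fun x => frobRow σ ε (t * x)
  have hD : Module.finrank F (Submodule.span F (D : Set (Fin w → F))) ≤ I.card - (r + 1) := by
    refine (finrank_span_finset_le_card D).trans (Finset.card_image_le.trans ?_)
    rw [Finset.card_sdiff_of_subset hJI, hJc]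
  have hsup := Submodule.finrank_add_le_finrank_add_finrank Y
    (Submodule.span F (D : Set (Fin w → F)))
  have := le_finrank_of_frobRow_mem hσ hε ht (t * k 0) (N := I.card)
    (Y ⊔ Submodule.span F (D : Set (Fin w → F))) (fun i hi => by
      rw [← mul_add]
      have hiI : k 0 + (i : ℕ) ∈ I := Finset.mem_Icc.2 ⟨by omega, by omega⟩
      by_cases hJ : k 0 + (i : ℕ) ∈ J
      · obtain ⟨j, -, hj⟩ := Finset.mem_image.1 hJ
        rw [← hj]
        exact Submodule.mem_sup_left (Submodule.subset_span ⟨j, rfl⟩)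
      · exact Submodule.mem_sup_right (Submodule.subset_span
          (Finset.mem_coe.2 (Finset.mem_image.2 ⟨_, Finset.mem_sdiff.2 ⟨hiI, hJ⟩, rfl⟩))))
  omega

/-- The rank-metric Roos bound, stated for a dependency between Frobenius rows. -/
lemma eq_zero_of_roos_s14 {σ : F ≃+* F} {m : ℕ} (hσ : σ ^ m = 1) {ν : ℕ} {ε : Fin ν → F}
    (hε : LinearIndependent (fixedField σ) ε) {a t s : ℤ} (ht : Int.gcd (m : ℤ) t = 1)
    (hs : Int.gcd (m : ℤ) s = 1) {N r : ℕ} {k : Fin (r + 1) → ℤ} (hk : StrictMono k)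
    (hkL : k (Fin.last r) - k 0 + 1 ≤ N + r) (hν : ν ≤ N + r) {g : Fin ν → F}
    (hg : ∀ i < N, ∀ j, ∑ l, g l * (σ ^ (-(a + t * (i : ℕ) + s * k j))) (ε l) = 0) : g = 0 := by
  let K := fixedField σ
  let S := Submodule.span K (Set.range g)
  have hfinite : Module.Finite K S := Module.Finite.span_of_finite K (Set.finite_range g)
  let γ' := Module.finBasis K S
  set w := Module.finrank K S with hw
  let γ : Fin w → F := fun i => (γ' i : F)
  have hγ : LinearIndependent K γ := γ'.linearIndependent.map' S.subtype S.ker_subtype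
  have hγS : Submodule.span K (Set.range γ) = Submodule.span K (Set.range g) := by
    have : Set.range γ = S.subtype '' Set.range γ' := by
      rw [← Set.range_comp]; rfl
    rw [this, ← Submodule.map_span, γ'.span_eq, Submodule.map_subtype_top]
  let D : Fin w → Fin ν → K := fun i l => γ'.repr ⟨g l, Submodule.subset_span ⟨l, rfl⟩⟩ i
  have hD : ∀ l, g l = ∑ i, D i l • γ i := fun l => by
    have := congrArg S.subtype (γ'.sum_repr ⟨g l, Submodule.subset_span ⟨l, rfl⟩⟩)
    rw [map_sum] at this
    exact this.symm
  have hε' := linearIndependent_sum_smul_of_span_eq hγ hε hγS D hD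
  set ε' : Fin w → F := fun i => ∑ l, D i l • ε l with hε'def
  have hwν : w ≤ ν := (finrank_range_le_card g).trans_eq (Fintype.card_fin ν)
  by_contra hg0
  have hw0 : 0 < w := by
    rcases Nat.eq_zero_or_pos w with h0 | h0
    · refine absurd (funext fun l => ?_) hg0
      have : IsEmpty (Fin w) := by rw [h0]; infer_instance
      rw [hD l, Finset.univ_eq_empty, Finset.sum_empty, Pi.zero_apply]
    · exact h0
  have hsum : ∀ i < N, ∀ j, ∑ q, γ q * (σ ^ (-(a + t * (i : ℕ) + s * k j))) (ε' q) = 0 := by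
    intro i hi j
    rw [← hg i hi j]
    simp only [hD, hε'def, Subfield.smul_def, smul_eq_mul, map_sum, map_mul,
      zpow_apply_eq_of_apply_eq σ (D _ _).2, Finset.mul_sum, Finset.sum_mul]
    rw [Finset.sum_comm]
    exact Finset.sum_congr rfl fun _ _ => Finset.sum_congr rfl fun _ _ => by ring
  have hs' : Int.gcd (m : ℤ) (-s) = 1 := by rwa [Int.gcd_neg]
  obtain ⟨L, hL, hrL, hfin⟩ := min_le_finrank_span_frobRow_add hσ hε' hs' hk
  have hX := le_finrank_of_frobRow_mem hσ hγ ht a (N := N)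
    (Submodule.span F (Set.range fun i : Fin N => frobRow σ γ (a + t * (i : ℕ))))
    (fun i hi => Submodule.subset_span ⟨⟨i, hi⟩, rfl⟩)
  have hY : 1 ≤ Module.finrank F
      (Submodule.span F (Set.range fun j => frobRow σ ε' (-s * k j))) := by
    have := le_finrank_of_frobRow_mem hσ hε' ht (-s * k 0) (N := 1)
      (Submodule.span F (Set.range fun j => frobRow σ ε' (-s * k j)))
      (fun i hi => Submodule.subset_span ⟨0, by
        obtain rfl : i = 0 := by omega
        simp⟩)
    omega
  have horth := finrank_span_add_finrank_span_le
    (S := Set.range fun i : Fin N => frobRow σ γ (a + t * (i : ℕ)))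
    (T := Set.range fun j => frobRow σ ε' (-s * k j)) (by
      rintro _ ⟨i, rfl⟩ _ ⟨j, rfl⟩
      have := congrArg (σ ^ (a + t * ((i : ℕ) : ℤ))) (hsum i i.2 j)
      rw [map_sum, map_zero] at this
      rw [← this]
      refine Finset.sum_congr rfl fun q _ => ?_
      rw [map_mul, ← zpow_add_apply_s14]
      simp only [frobRow]
      congr 3
      ring)
  omega

end SkewMoore

/-- Under the error-correcting capacity assumption, the error locator vector is, up to
nonzero scalar multiples, the unique shortest `σ^{-t1}`-skew-feedback shift register
generating the twisted syndrome sequences. -/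
theorem error_locator_is_shortest_sfsr {F : Type*} [Field F]
    (σ : F ≃+* F) (m : ℕ) (hm0 : 0 < m) (hord : orderOf σ = m)
    {n : ℕ} (hn : n ≤ m) (h : Fin n → F)
    (hh : LinearIndependent (fixedField σ) h)
    (C : Set (Fin n → F))
    (δ r : ℕ) (hδ : 2 ≤ δ) (b t1 t2 : ℤ) (ht1 : Int.gcd (m : ℤ) t1 = 1)
    (kk : Fin (r + 1) → ℤ) (hkk : StrictMono kk)
    (hT : ∀ i : ℕ, i ≤ δ - 2 → ∀ j : Fin (r + 1),
      b + t1 * (i : ℤ) + t2 * kk j ∈ definingSet σ h C)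
    (y c e : Fin n → F) (hc : c ∈ C) (hy : y = c + e)
    (ν : ℕ) (hν : rankWeight σ e = ν)
    (ε : Fin ν → F) (hεli : LinearIndependent (fixedField σ) ε)
    (hεspan : Submodule.span (fixedField σ) (Set.range ε) =
      Submodule.span (fixedField σ) (Set.range e))
    (B : Matrix (Fin ν) (Fin n) F) (hBmem : ∀ k l, B k l ∈ fixedField σ)
    (hB : e = Matrix.vecMul ε B)
    (hBuniq : ∀ B' : Matrix (Fin ν) (Fin n) F, (∀ k l, B' k l ∈ fixedField σ) →
      e = Matrix.vecMul ε B' → B' = B)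
    (η : Fin ν → F) (hη : ∀ k, η k = ∑ l, B k l * h l)
    (lc : Fin (ν + 1) → F) (hlclast : lc (Fin.last ν) = 1)
    (hlc : ∀ k, ∑ l : Fin (ν + 1), lc l * (σ ^ (-(t1 * ((l : ℕ) : ℤ)))) (η k) = 0)
    (st : Fin (r + 1) → ℕ → F)
    (hst : ∀ j i, st j i = (σ ^ (-(b + t1 * (i : ℤ) + t2 * kk j)))
      (∑ l, y l * (σ ^ (b + t1 * (i : ℤ) + t2 * kk j)) (h l)))
    (hνδ : ν ≤ δ - 2)
    (hassump : ∃ (b' t1' t2' : ℤ) (δ' r' : ℕ), 2 ≤ δ' ∧ ν < δ' + r' ∧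
      ((Int.gcd (m : ℤ) t1' = 1 ∧ Int.gcd (m : ℤ) t2' < δ' ∧
        ∀ i : ℕ, i ≤ δ' - 2 → ∀ j : ℕ, j ≤ r' →
          ∃ (i' : ℕ) (j' : Fin (r + 1)), i' ≤ δ - 2 - ν ∧
            (m : ℤ) ∣ (b' + t1' * (i : ℤ) + t2' * (j : ℤ)) -
              (b + t1 * ((ν : ℤ) + (i' : ℤ)) + t2 * kk j'))
       ∨
       (Int.gcd (m : ℤ) t1' = 1 ∧ Int.gcd (m : ℤ) t2' = 1 ∧
        ∃ k' : Fin (r' + 1) → ℤ, StrictMono k' ∧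
          k' (Fin.last r') - k' 0 ≤ (δ' : ℤ) + (r' : ℤ) - 2 ∧
          ∀ i : ℕ, i ≤ δ' - 2 → ∀ j : Fin (r' + 1),
            ∃ (i' : ℕ) (j' : Fin (r + 1)), i' ≤ δ - 2 - ν ∧
              (m : ℤ) ∣ (b' + t1' * (i : ℤ) + t2' * k' j) -
                (b + t1 * ((ν : ℤ) + (i' : ℤ)) + t2 * kk j')))) :
    IsSFSR (σ ^ (-t1)) (r + 1) (δ - 1) st ν lc ∧
    ∀ ℓ' : ℕ, ℓ' ≤ ν → ∀ w : Fin (ℓ' + 1) → F, IsSFSR (σ ^ (-t1)) (r + 1) (δ - 1) st ℓ' w →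
      ∃ hl : ℓ' = ν, ∃ c' : F, c' ≠ 0 ∧
        ∀ l : Fin (ℓ' + 1), w l = c' * lc (Fin.cast (by omega) l) := by
  have hσ : σ ^ m = 1 := hord ▸ pow_orderOf_eq_one σ
  have hηli : LinearIndependent (fixedField σ) η := by
    have := linearIndependent_sum_smul_of_span_eq hεli hh hεspan
      (fun k l => (⟨B k l, hBmem k l⟩ : fixedField σ)) (fun l => by
        rw [hB]
        simp only [Matrix.vecMul, dotProduct, Subfield.smul_def, smul_eq_mul]
        exact Finset.sum_congr rfl fun _ _ => mul_comm _ _)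
    rwa [show η = fun k => ∑ l, (⟨B k l, hBmem k l⟩ : fixedField σ) • h l from funext hη]
  have ht1' : Int.gcd (m : ℤ) (-t1) = 1 := by rwa [Int.gcd_neg]
  have hsyn : ∀ (j : Fin (r + 1)) (i : ℕ), i ≤ δ - 2 →
      st j i = ∑ k, (σ ^ (-(b + t1 * (i : ℤ) + t2 * kk j))) (ε k) * η k := by
    intro j i hi
    rw [hst, hy]
    have hcz := hT i hi j c hc
    set p := b + t1 * (i : ℤ) + t2 * kk j
    simp only [Pi.add_apply, add_mul, Finset.sum_add_distrib]
    rw [hcz, zero_add, map_sum]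
    simp only [map_mul, zpow_neg_apply_zpow, hη, Finset.mul_sum]
    rw [Finset.sum_comm]
    refine Finset.sum_congr rfl fun l _ => ?_
    rw [hB]
    simp only [Matrix.vecMul, dotProduct, map_sum, map_mul, Finset.sum_mul]
    refine Finset.sum_congr rfl fun k _ => ?_
    rw [zpow_apply_eq_of_apply_eq σ (hBmem k l)]
    ring
  have hkey : ∀ (ℓ : ℕ) (w : Fin (ℓ + 1) → F) (j : Fin (r + 1)) (N : ℕ), ℓ ≤ N → N ≤ δ - 2 →
      ∑ i : Fin (ℓ + 1), w i * ((σ ^ (-t1)) ^ (i : ℕ)) (st j (N - (i : ℕ))) =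
      ∑ k, (∑ i : Fin (ℓ + 1), w i * (σ ^ (-(t1 * ((i : ℕ) : ℤ)))) (η k)) *
        (σ ^ (-(b + t1 * (N : ℤ) + t2 * kk j))) (ε k) := by
    intro ℓ w j N hℓ hN
    simp only [Finset.sum_mul]
    rw [Finset.sum_comm]
    refine Finset.sum_congr rfl fun i _ => ?_
    have hi : (i : ℕ) ≤ N := (Nat.lt_succ_iff.1 i.2).trans hℓ
    rw [hsyn j _ ((Nat.sub_le _ _).trans hN), ← zpow_natCast, ← zpow_mul, map_sum,
      Finset.mul_sum]
    refine Finset.sum_congr rfl fun k _ => ?_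
    rw [map_mul, ← zpow_add_apply_s14, neg_mul, Nat.cast_sub hi,
      show -(t1 * ((i : ℕ) : ℤ)) + -(b + t1 * ((N : ℤ) - ((i : ℕ) : ℤ)) + t2 * kk j) =
        -(b + t1 * (N : ℤ) + t2 * kk j) by ring]
    ring
  refine ⟨⟨?_, ?_⟩, ?_⟩
  · intro h0
    have hli := Fintype.linearIndependent_iff.1
      (linearIndependent_frobRow hσ hηli ht1' (-t1) le_rfl) (fun i => lc i.succ) (by
        funext k
        have := hlc k
        rw [Fin.sum_univ_succ, h0, zero_mul, zero_add] at this
        rw [Finset.sum_apply, Pi.zero_apply, ← this]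
        refine Finset.sum_congr rfl fun i _ => ?_
        simp only [Pi.smul_apply, smul_eq_mul, frobRow]
        congr 3
        push_cast [Fin.val_succ]
        ring)
    have hz : ∀ l, lc l = 0 := Fin.cases h0 hli
    exact one_ne_zero (hlclast.symm.trans (hz _))
  · intro j N hN1 hN2
    rw [hkey ν lc j N hN1 (by omega)]
    simp only [hlc, zero_mul, Finset.sum_const_zero]
  · intro ℓ' hℓ' w hw
    obtain ⟨hw0, hw⟩ := hw
    set g : Fin ν → F := fun k =>
      ∑ i : Fin (ℓ' + 1), w i * (σ ^ (-(t1 * ((i : ℕ) : ℤ)))) (η k) with hg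
    have hgT : ∀ p : ℤ, (∃ (i' : ℕ) (j' : Fin (r + 1)), i' ≤ δ - 2 - ν ∧
        (m : ℤ) ∣ p - (b + t1 * ((ν : ℤ) + (i' : ℤ)) + t2 * kk j')) →
        ∑ k, g k * (σ ^ (-p)) (ε k) = 0 := by
      rintro p ⟨i', j', hi', hdvd⟩
      rw [zpow_neg, zpow_eq_zpow_of_dvd hσ hdvd, ← zpow_neg]
      have := hw j' (ν + i') (by omega) (by omega)
      rw [hkey ℓ' w j' (ν + i') (by omega) (by omega)] at this
      push_cast at this
      exact this
    have hg0 : g = 0 := by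
      obtain ⟨b', t1', t2', δ', r', hδ', hνδ', hcase⟩ := hassump
      rcases hcase with ⟨h1, h2, h3⟩ | ⟨h1, h2, k', hk', hkL, h3⟩
      · have := hartmannTzeng_le_finrank hm0 hσ hεli (a := -b') (t := -t1') (s := -t2')
          (by rwa [Int.gcd_neg]) (N := δ' - 1) (by rw [Int.gcd_neg]; omega) r'
        rw [min_eq_left (by omega)] at this
        refine eq_zero_of_dotProduct_eq_zero_of_le_finrank this ?_
        rintro _ ⟨i, hi, j, hj, rfl⟩
        rw [← hgT _ (h3 i (by omega) j hj)]
        simp only [frobRow]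
        refine Finset.sum_congr rfl fun k _ => ?_
        congr 3
        ring
      · exact eq_zero_of_roos_s14 hσ hεli h1 h2 (N := δ' - 1) hk' (by omega) (by omega)
          (fun i hi j => hgT _ (h3 i (by omega) j))
    have hvanish : ∀ k, ∑ i : Fin (ℓ' + 1), w i * (σ ^ (-(t1 * ((i : ℕ) : ℤ)))) (η k) = 0 :=
      fun k => congrFun hg0 k
    rcases Nat.lt_or_ge ℓ' ν with hlt | hge
    · refine absurd (Fintype.linearIndependent_iff.1
        (linearIndependent_frobRow hσ hηli ht1' 0 (N := ℓ' + 1) hlt) w ?_ 0) hw0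
      funext k
      rw [Finset.sum_apply, Pi.zero_apply, ← hvanish k]
      refine Finset.sum_congr rfl fun i _ => ?_
      simp only [Pi.smul_apply, smul_eq_mul, frobRow, zero_add, neg_mul]
    · obtain rfl : ℓ' = ν := le_antisymm hℓ' hge
      have hz := Fintype.linearIndependent_iff.1
        (linearIndependent_frobRow hσ hηli ht1' 0 le_rfl)
        (fun i => w i.castSucc - w (Fin.last ℓ') * lc i.castSucc) (by
          funext k
          have e1 := hvanish k
          have e2 := hlc k
          rw [Fin.sum_univ_castSucc] at e1 e2
          rw [hlclast, one_mul] at e2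
          simp only [Finset.sum_apply, Pi.zero_apply, Pi.smul_apply, smul_eq_mul, frobRow,
            zero_add, neg_mul, sub_mul, Finset.sum_sub_distrib, mul_assoc, ← Finset.mul_sum]
          simp only [Fin.val_castSucc] at e1 e2
          linear_combination e1 - w (Fin.last ℓ') * e2)
      have hwl : ∀ l, w l = w (Fin.last ℓ') * lc l := fun l =>
        Fin.lastCases (by rw [hlclast, mul_one]) (fun i => sub_eq_zero.1 (hz i)) l
      refine ⟨rfl, w (Fin.last ℓ'), fun h0 => hw0 ?_, hwl⟩
      rw [hwl, h0, zero_mul]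
end
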